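/- Fix α ∈ (0,1), ν > 0, and positive integers n ≥ 2, k ≤ n, p, λ with m = pλ. Let v ∈ ℝ^λ be a nonzero row vector, γ = ‖v‖₁/‖v‖₂, V = I_p ⊗ v, and V̂ = (1/(‖v‖₂√p))·V. There exists a universal constant C₂ > 0 such that if m ≥ p ≥ C₂·k·(log⁴(n) + γ²ν)/α², then for Φ ∈ ℝ^{m×n} drawn from the sign-randomized partial circulant ensemble, P( sup_{x∈T_k} | ‖V̂Φx‖₂² − ‖x‖₂² | ≤ α ) ≥ 1 − e^{−ν}. -/

import Mathlib

open scoped BigOperators Matrix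
noncomputable section

/-- The sign `±1` associated with a boolean. -/
def rsign (b : Bool) : ℝ := if b then 1 else -1

/-- `ℓ¹` norm of a real vector. -/
def norm1 {n : ℕ} (x : Fin n → ℝ) : ℝ := ∑ j, |x j|

/-- Euclidean norm of a real vector. -/
def norm2 {n : ℕ} (x : Fin n → ℝ) : ℝ := Real.sqrt (∑ j, (x j) ^ 2)

/-- `T_k` (real version): unit-norm vectors with at most `k` nonzero entries. -/
def TkR (n k : ℕ) : Set (Fin n → ℝ) :=
  {x | norm2 x = 1 ∧ ∃ s : Finset (Fin n), s.card ≤ k ∧ ∀ t ∉ s, x t = 0}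

/-- Block-diagonal matrix `I_p ⊗ v` with `p` copies of the row vector `v` on the diagonal. -/
def kronRow (p : ℕ) {lam : ℕ} (v : Fin lam → ℝ) : Matrix (Fin p) (Fin (p * lam)) ℝ :=
  Matrix.of fun i j =>
    if (j : ℕ) / lam = (i : ℕ) then
      (if h2 : (j : ℕ) % lam < lam then v ⟨(j : ℕ) % lam, h2⟩ else 0)
    else 0

/-- Probability of an event under the uniform distribution on a finite sample space. -/
def unifProb {Ω : Type*} [Fintype Ω] (P : Ω → Prop) : ℝ :=
  (Nat.card {ω : Ω // P ω} : ℝ) / (Fintype.card Ω : ℝ)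

section Auxiliary

open Finset

/-- The real vector with entries `±1` given by a vector of signs. -/
def signVec {J : Type*} (s : J → ℤˣ) : J → ℝ := fun j => ((s j : ℤ) : ℝ)

/-- Euclidean length of a real vector on a finite index type. -/
def euclLen {J : Type*} [Fintype J] (u : J → ℝ) : ℝ := √(∑ j, u j ^ 2)

lemma signVec_sq {J : Type*} (s : J → ℤˣ) (j : J) : signVec s j ^ 2 = 1 := by
  rcases Int.units_eq_one_or (s j) with h | h <;> simp [signVec, h]

lemma euclLen_nonneg {J : Type*} [Fintype J] (u : J → ℝ) : 0 ≤ euclLen u := Real.sqrt_nonneg _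

lemma euclLen_sq {J : Type*} [Fintype J] (u : J → ℝ) : euclLen u ^ 2 = ∑ j, u j ^ 2 :=
  Real.sq_sqrt (Finset.sum_nonneg fun _ _ => sq_nonneg _)

lemma euclLen_signVec {J : Type*} [Fintype J] (s : J → ℤˣ) :
    euclLen (signVec s) = √(Fintype.card J) := by
  simp [euclLen, signVec_sq]

lemma euclLen_mul_le {J : Type*} [Fintype J] {a : J → ℝ} (ha : ∀ j, |a j| ≤ 1) (u : J → ℝ) :
    euclLen (a * u) ≤ euclLen u := by
  refine Real.sqrt_le_sqrt (Finset.sum_le_sum fun j _ => ?_)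
  rw [Pi.mul_apply, mul_pow]
  have : a j ^ 2 ≤ 1 := (sq_le_one_iff_abs_le_one _).2 (ha j)
  nlinarith [sq_nonneg (u j)]

/-- The moment generating function of a Rademacher sum is sub-Gaussian. -/
lemma expect_exp_signVec_le {J : Type*} [Fintype J] [DecidableEq J] (u : J → ℝ) :
    𝔼 s : J → ℤˣ, Real.exp (∑ j, signVec s j * u j) ≤ Real.exp ((∑ j, u j ^ 2) / 2) := by
  have h1 : ∑ s : J → ℤˣ, Real.exp (∑ j, signVec s j * u j)
      = ∏ j, (2 * Real.cosh (u j)) := by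
    have h2 := Finset.prod_univ_sum (R := ℝ) (fun _ : J => (Finset.univ : Finset ℤˣ))
      (fun j η => Real.exp (((η : ℤ) : ℝ) * u j))
    rw [Fintype.piFinset_univ] at h2
    simp only [Real.exp_sum, signVec]
    rw [← h2]
    refine Finset.prod_congr rfl fun j _ => ?_
    rw [UnitsInt.univ, Finset.sum_pair (by decide), Real.cosh_eq]
    simp
    ring
  rw [Fintype.expect_eq_sum_div_card, h1, Finset.prod_mul_distrib]
  have hc : (Fintype.card (J → ℤˣ) : ℝ) = 2 ^ Fintype.card J := by
    simp [Fintype.card_pi]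
  rw [hc, Finset.prod_const, Finset.card_univ, mul_div_cancel_left₀ _ (by positivity),
    Finset.sum_div, Real.exp_sum]
  exact Finset.prod_le_prod (fun j _ => (Real.cosh_pos _).le)
    fun j _ => Real.cosh_le_exp_half_sq _

/-- Power-mean inequality for averages. -/
lemma expect_pow_le_expect_pow {Ω : Type*} [Fintype Ω] [Nonempty Ω] (f : Ω → ℝ)
    (hf : ∀ ω, 0 ≤ f ω) (q : ℕ) : (𝔼 ω, f ω) ^ q ≤ 𝔼 ω, f ω ^ q := by
  have h := Real.pow_arith_mean_le_arith_mean_pow Finset.univ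
    (fun _ : Ω => ((Fintype.card Ω : ℝ))⁻¹) f (fun _ _ => by positivity)
    (by simp) (fun i _ => hf i) q
  rw [Fintype.expect_eq_sum_div_card, Fintype.expect_eq_sum_div_card, div_eq_inv_mul,
    div_eq_inv_mul, Finset.mul_sum, Finset.mul_sum]
  exact h

/-- A form of Minkowski's inequality for averages of powers. -/
lemma expect_sum_pow_le {Ω ι : Type*} [Fintype Ω] [Nonempty Ω] (t : Finset ι) (ht : t.Nonempty)
    (f : ι → Ω → ℝ) (b : ι → ℝ) (K : ℝ) (q : ℕ) (hf : ∀ i ω, 0 ≤ f i ω) (hb : ∀ i, 0 < b i)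
    (h : ∀ i ∈ t, 𝔼 ω, f i ω ^ q ≤ b i ^ q * K) :
    𝔼 ω, (∑ i ∈ t, f i ω) ^ q ≤ (∑ i ∈ t, b i) ^ q * K := by
  set B := ∑ i ∈ t, b i with hB
  have hBpos : 0 < B := Finset.sum_pos (fun i _ => hb i) ht
  have h1 : ∀ ω, (∑ i ∈ t, f i ω) ^ q ≤ B ^ q * ∑ i ∈ t, b i / B * (f i ω / b i) ^ q := by
    intro ω
    have h2 := Real.pow_arith_mean_le_arith_mean_pow t (fun i => b i / B)
      (fun i => f i ω / b i) (fun i _ => by have := hb i; positivity)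
      (by rw [← Finset.sum_div, ← hB, div_self hBpos.ne'])
      (fun i _ => div_nonneg (hf i ω) (hb i).le) q
    have h3 : ∑ i ∈ t, b i / B * (f i ω / b i) = (∑ i ∈ t, f i ω) / B := by
      rw [Finset.sum_div]
      refine Finset.sum_congr rfl fun i _ => ?_
      have := (hb i).ne'
      field_simp
    rw [h3, div_pow, div_le_iff₀ (by positivity)] at h2
    linarith
  calc 𝔼 ω, (∑ i ∈ t, f i ω) ^ q
      ≤ 𝔼 ω, B ^ q * ∑ i ∈ t, b i / B * (f i ω / b i) ^ q :=
        Finset.expect_le_expect fun ω _ => h1 ω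
    _ = B ^ q * ∑ i ∈ t, b i / B * ((𝔼 ω, f i ω ^ q) / b i ^ q) := by
        rw [← Finset.mul_expect, Finset.expect_sum_comm]
        congr 1
        refine Finset.sum_congr rfl fun i _ => ?_
        rw [← Finset.mul_expect, Finset.expect_div]
        simp only [div_pow]
    _ ≤ B ^ q * ∑ i ∈ t, b i / B * K := by
        gcongr with i hi
        · have := hb i; positivity
        · rw [div_le_iff₀ (pow_pos (hb i) q)]
          linarith [h i hi]
    _ = B ^ q * K := by
        rw [← Finset.sum_mul, ← Finset.sum_div, ← hB, div_self hBpos.ne', one_mul]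

/-- Moments of the maximum of finitely many Rademacher sums. -/
lemma expect_max_pow_le {J κ : Type*} [Fintype J] [DecidableEq J] [Fintype κ] [Nonempty κ]
    (u : κ → J → ℝ) (D : ℝ) (hD : 0 ≤ D) (hu : ∀ k, ∑ j, u k j ^ 2 ≤ D ^ 2)
    (R : (J → ℤˣ) → ℝ) (hR0 : ∀ s, 0 ≤ R s)
    (hR : ∀ s, ∃ k, R s ≤ |∑ j, signVec s j * u k j|) (q : ℕ) (hq : 1 ≤ q) :
    𝔼 s, R s ^ q ≤ (8 * D * √(q + Real.log (Fintype.card κ))) ^ q := by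
  rcases hD.eq_or_lt with rfl | hD
  · have hR1 : ∀ s, R s = 0 := by
      intro s
      obtain ⟨k, hk⟩ := hR s
      have h1 : ∀ j, u k j = 0 := by
        intro j
        have h2 : ∑ j, u k j ^ 2 = 0 :=
          le_antisymm (by simpa using hu k) (Finset.sum_nonneg fun _ _ => sq_nonneg _)
        have h3 := (Finset.sum_eq_zero_iff_of_nonneg (fun _ _ => sq_nonneg _)).1 h2 j
          (Finset.mem_univ j)
        exact pow_eq_zero_iff (two_ne_zero) |>.1 h3
      refine le_antisymm ?_ (hR0 s)
      simpa [h1] using hk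
    have hq' : q ≠ 0 := by omega
    simp [hR1, hq']
  set M : ℝ := ((Fintype.card κ : ℕ) : ℝ) with hM
  have hM1 : 1 ≤ M := by
    rw [hM]; exact_mod_cast Fintype.card_pos
  set Λ : ℝ := q + Real.log M with hΛ
  have hlogM : 0 ≤ Real.log M := Real.log_nonneg hM1
  have hq1 : (1 : ℝ) ≤ q := by exact_mod_cast hq
  have hΛ1 : 1 ≤ Λ := by linarith
  have hsq : √Λ ^ 2 = Λ := Real.sq_sqrt (by linarith)
  have hsqpos : 0 < √Λ := Real.sqrt_pos.2 (by linarith)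
  set y : ℝ := 2 * D * √Λ with hy
  set a : ℝ := 2 * √Λ / D with ha
  have hapos : 0 < a := by positivity
  have hypos : 0 < y := by positivity
  have hay : a * y = 4 * Λ := by
    rw [ha, hy]; field_simp; rw [hsq]; ring
  have haD : a ^ 2 * D ^ 2 = 4 * Λ := by
    rw [ha]; field_simp; rw [hsq]; ring
  have hpt : ∀ s, R s ^ q ≤ 2 ^ q * (y ^ q + (q.factorial : ℝ) / a ^ q * Real.exp (-(a * y)) *
      ∑ k, (Real.exp (∑ j, signVec s j * (a * u k j)) +
        Real.exp (∑ j, signVec s j * (-a * u k j)))) := by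
    intro s
    obtain ⟨k, hk⟩ := hR s
    have hsum : Real.exp (a * R s) ≤ ∑ k, (Real.exp (∑ j, signVec s j * (a * u k j)) +
        Real.exp (∑ j, signVec s j * (-a * u k j))) := by
      refine le_trans ?_ (Finset.single_le_sum (f := fun k =>
        Real.exp (∑ j, signVec s j * (a * u k j)) +
        Real.exp (∑ j, signVec s j * (-a * u k j))) (fun _ _ => by positivity) (Finset.mem_univ k))
      have e1 : ∑ j, signVec s j * (a * u k j) = a * ∑ j, signVec s j * u k j := by
        rw [Finset.mul_sum]; exact Finset.sum_congr rfl fun _ _ => by ring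
      have e2 : ∑ j, signVec s j * (-a * u k j) = -(a * ∑ j, signVec s j * u k j) := by
        rw [Finset.mul_sum, ← Finset.sum_neg_distrib]
        exact Finset.sum_congr rfl fun _ _ => by ring
      simp only [e1, e2]
      have h3 : a * R s ≤ |a * ∑ j, signVec s j * u k j| := by
        rw [abs_mul, abs_of_pos hapos]
        exact mul_le_mul_of_nonneg_left hk hapos.le
      refine (Real.exp_le_exp.2 h3).trans ?_
      exact Real.exp_abs_le _
    rcases le_or_gt (R s) y with hle | hgt
    · have h4 : R s ^ q ≤ y ^ q := pow_le_pow_left₀ (hR0 s) hle q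
      have h5 : (1 : ℝ) ≤ 2 ^ q := one_le_pow₀ (by norm_num)
      have h6 : 0 ≤ (q.factorial : ℝ) / a ^ q * Real.exp (-(a * y)) *
        ∑ k, (Real.exp (∑ j, signVec s j * (a * u k j)) +
        Real.exp (∑ j, signVec s j * (-a * u k j))) := by positivity
      have h7 : 0 ≤ y ^ q := by positivity
      nlinarith
    · have hz : 0 ≤ R s - y := by linarith
      have h4 := add_pow_le hypos.le hz q
      rw [add_sub_cancel] at h4
      have h5 : (a * (R s - y)) ^ q / q.factorial ≤ Real.exp (a * (R s - y)) :=
        Real.pow_div_factorial_le_exp _ (by positivity) q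
      have h6 : (R s - y) ^ q ≤ (q.factorial : ℝ) / a ^ q * Real.exp (a * (R s - y)) := by
        rw [mul_pow, div_le_iff₀ (by positivity)] at h5
        rw [div_mul_eq_mul_div, le_div_iff₀ (by positivity)]
        linarith
      have h7 : Real.exp (a * (R s - y)) = Real.exp (-(a * y)) * Real.exp (a * R s) := by
        rw [← Real.exp_add]; ring_nf
      have h8 : (2 : ℝ) ^ (q - 1) ≤ 2 ^ q := pow_le_pow_right₀ (by norm_num) (by omega)
      calc R s ^ q ≤ 2 ^ (q - 1) * (y ^ q + (R s - y) ^ q) := h4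
        _ ≤ 2 ^ q * (y ^ q + (R s - y) ^ q) := by
            gcongr
        _ ≤ _ := by
            refine mul_le_mul_of_nonneg_left (add_le_add_right ?_ _) (by positivity)
            refine h6.trans ?_
            rw [h7, ← mul_assoc]
            exact mul_le_mul_of_nonneg_left hsum (by positivity)
  have hexp : ∀ (c : ℝ), c ^ 2 = a ^ 2 → ∀ k,
      𝔼 s : J → ℤˣ, Real.exp (∑ j, signVec s j * (c * u k j)) ≤ Real.exp (2 * Λ) := by
    intro c hc k
    refine (expect_exp_signVec_le _).trans (Real.exp_le_exp.2 ?_)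
    simp only [mul_pow, hc, ← Finset.mul_sum]
    have := mul_le_mul_of_nonneg_left (hu k) (sq_nonneg a)
    linarith
  have hmain : 𝔼 s, R s ^ q ≤ 2 ^ q * (y ^ q + (q.factorial : ℝ) / a ^ q * Real.exp (-(a * y)) *
      (M * (2 * Real.exp (2 * Λ)))) := by
    refine (Finset.expect_le_expect fun s _ => hpt s).trans ?_
    rw [← Finset.mul_expect, Finset.expect_add_distrib, Fintype.expect_const, ← Finset.mul_expect,
      Finset.expect_sum_comm]
    gcongr
    calc ∑ k, 𝔼 s, (Real.exp (∑ j, signVec s j * (a * u k j)) +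
        Real.exp (∑ j, signVec s j * (-a * u k j)))
        ≤ ∑ _k : κ, 2 * Real.exp (2 * Λ) := by
          refine Finset.sum_le_sum fun k _ => ?_
          rw [Finset.expect_add_distrib]
          linarith [hexp a rfl k, hexp (-a) (by ring) k]
      _ = M * (2 * Real.exp (2 * Λ)) := by simp [hM]
  refine hmain.trans ?_
  have hM2 : M = Real.exp (Real.log M) := (Real.exp_log (by linarith)).symm
  have hsmall : Real.exp (-(a * y)) * (M * (2 * Real.exp (2 * Λ))) ≤ 1 := by
    have h2 : (2 : ℝ) ≤ Real.exp 1 := by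
      have := Real.add_one_le_exp (1 : ℝ); linarith
    rw [hay]
    calc Real.exp (-(4 * Λ)) * (M * (2 * Real.exp (2 * Λ)))
        ≤ Real.exp (-(4 * Λ)) * (Real.exp (Real.log M) * (Real.exp 1 * Real.exp (2 * Λ))) := by
          rw [← hM2]; gcongr
      _ = Real.exp (-(4 * Λ) + (Real.log M + (1 + 2 * Λ))) := by
          rw [Real.exp_add, Real.exp_add, Real.exp_add]
      _ ≤ 1 := Real.exp_le_one_iff.2 (by linarith)
  have hfac : (q.factorial : ℝ) / a ^ q ≤ y ^ q := by
    have h1 : (q.factorial : ℝ) ≤ (q : ℝ) ^ q := by exact_mod_cast Nat.factorial_le_pow q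
    rw [div_le_iff₀ (by positivity), ← mul_pow]
    refine h1.trans (pow_le_pow_left₀ (by positivity) ?_ q)
    rw [mul_comm, hay]; linarith
  calc 2 ^ q * (y ^ q + (q.factorial : ℝ) / a ^ q * Real.exp (-(a * y)) *
      (M * (2 * Real.exp (2 * Λ))))
      ≤ 2 ^ q * (y ^ q + y ^ q * 1) := by
        rw [mul_assoc ((q.factorial : ℝ) / a ^ q)]
        gcongr
    _ = 2 * (2 * y) ^ q := by rw [mul_pow 2 y]; ring
    _ ≤ 2 ^ q * (2 * y) ^ q := by
        gcongr
        calc (2 : ℝ) = 2 ^ 1 := by norm_num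
          _ ≤ 2 ^ q := pow_le_pow_right₀ (by norm_num) hq
    _ = (8 * D * √Λ) ^ q := by rw [← mul_pow, hy]; ring_nf

lemma expect_prod {α β : Type*} [Fintype α] [Fintype β] (f : α × β → ℝ) :
    𝔼 w, f w = 𝔼 x, 𝔼 y, f (x, y) := by
  rw [← Finset.expect_product, Finset.univ_product_univ]

lemma linearMap_eq_sum_single {J H : Type*} [Fintype J] [DecidableEq J] [AddCommGroup H]
    [Module ℝ H] (B : (J → ℝ) →ₗ[ℝ] H) (u : J → ℝ) :
    B u = ∑ j, u j • B (Pi.single j 1) := by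
  conv_lhs => rw [← Finset.univ_sum_single u, map_sum]
  refine Finset.sum_congr rfl fun j _ => ?_
  rw [← map_smul, ← Pi.single_smul]
  simp

lemma sum_inner_single_sq_le {J H : Type*} [Fintype J] [DecidableEq J] [NormedAddCommGroup H]
    [InnerProductSpace ℝ H] (B : (J → ℝ) →ₗ[ℝ] H) (d : ℝ)
    (hB : ∀ s, ‖B s‖ ≤ d * euclLen s) (h : H) :
    ∑ j, (inner ℝ (B (Pi.single j 1)) h) ^ 2 ≤ (d * ‖h‖) ^ 2 := by
  set u : J → ℝ := fun j => inner ℝ (B (Pi.single j 1)) h with hu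
  have h1 : ∑ j, u j ^ 2 = inner ℝ (B u) h := by
    rw [linearMap_eq_sum_single B u, sum_inner]
    refine Finset.sum_congr rfl fun j _ => ?_
    rw [real_inner_smul_left, sq]
  have h2 : inner ℝ (B u) h ≤ d * euclLen u * ‖h‖ :=
    (real_inner_le_norm _ _).trans (mul_le_mul_of_nonneg_right (hB u) (norm_nonneg _))
  have h3 := euclLen_sq u
  have h4 := euclLen_nonneg u
  change ∑ j, u j ^ 2 ≤ _
  rw [← h3]
  rw [← h1, ← h3] at h2
  have h5 : euclLen u ≤ |d * ‖h‖| := by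
    by_contra hlt
    push Not at hlt
    have h6 := le_abs_self (d * ‖h‖)
    have h7 := abs_nonneg (d * ‖h‖)
    nlinarith
  calc euclLen u ^ 2 ≤ |d * ‖h‖| ^ 2 := pow_le_pow_left₀ h4 h5 2
    _ = _ := sq_abs _

/-- Moments of the maximum of finitely many increments, in one of the two sign vectors. -/
lemma expect_max_inner_pow_le {J H κ : Type*} [Fintype J] [DecidableEq J] [NormedAddCommGroup H]
    [InnerProductSpace ℝ H] [Finite κ] [Nonempty κ] (D : κ → (J → ℝ) →ₗ[ℝ] H) (h : κ → H)
    (d z M : ℝ) (hd : 0 ≤ d) (hz : 0 ≤ z) (hD : ∀ k s, ‖D k s‖ ≤ d * euclLen s)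
    (hh : ∀ k, ‖h k‖ ≤ z) (hM : Real.log (Nat.card κ) ≤ M) (a : J → ℝ) (ha : ∀ j, |a j| ≤ 1)
    (q : ℕ) (hq : 1 ≤ q) :
    𝔼 s : J → ℤˣ, (⨆ k, |inner ℝ (D k (a * signVec s)) (h k)|) ^ q
      ≤ (8 * d * √(q + M)) ^ q * z ^ q := by
  have := Fintype.ofFinite κ
  have key := expect_max_pow_le
    (fun k j => a j * inner ℝ (D k (Pi.single j 1)) (h k)) (d * z) (by positivity)
    (fun k => ?_) (fun s => ⨆ k, |inner ℝ (D k (a * signVec s)) (h k)|)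
    (fun s => Real.iSup_nonneg fun k => abs_nonneg _) (fun s => ?_) q hq
  · refine key.trans ?_
    rw [← mul_pow]
    rw [Nat.card_eq_fintype_card] at hM
    refine pow_le_pow_left₀ (by positivity) ?_ q
    calc 8 * (d * z) * √(q + Real.log (Fintype.card κ)) ≤ 8 * (d * z) * √(q + M) := by
          gcongr
      _ = 8 * d * √(q + M) * z := by ring
  · calc ∑ j, (a j * inner ℝ (D k (Pi.single j 1)) (h k)) ^ 2
        ≤ ∑ j, (inner ℝ (D k (Pi.single j 1)) (h k)) ^ 2 := by
          refine Finset.sum_le_sum fun j _ => ?_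
          rw [mul_pow]
          have : a j ^ 2 ≤ 1 := (sq_le_one_iff_abs_le_one _).2 (ha j)
          nlinarith [sq_nonneg (inner ℝ (D k (Pi.single j 1)) (h k))]
      _ ≤ (d * ‖h k‖) ^ 2 := sum_inner_single_sq_le (D k) d (hD k) (h k)
      _ ≤ (d * z) ^ 2 := by gcongr; exact hh k
  · obtain ⟨k, hk⟩ := exists_eq_ciSup_of_finite
      (f := fun k => |inner ℝ (D k (a * signVec s)) (h k)|)
    refine ⟨k, le_of_eq ?_⟩
    rw [← hk, linearMap_eq_sum_single (D k), sum_inner]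
    congr 1
    refine Finset.sum_congr rfl fun j _ => ?_
    rw [real_inner_smul_left, Pi.mul_apply]
    ring

/-- Chaining for a decoupled quadratic Rademacher process. -/
lemma expect_decoupled_pow_le {T J H : Type*} [Nonempty T] [Fintype J] [DecidableEq J]
    [NormedAddCommGroup H] [InnerProductSpace ℝ H] (A : T → (J → ℝ) →ₗ[ℝ] H)
    (B : ℕ → T → (J → ℝ) →ₗ[ℝ] H) (L q : ℕ) (hq : 1 ≤ q) (d M : ℕ → ℝ) (hd : ∀ r, 0 < d r)
    (hM0 : ∀ r, 0 ≤ M r)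
    (Z : (J → ℝ) → ℝ) (τ : ℝ) (hτ : 0 < τ) (hB0 : ∀ x, B 0 x = 0)
    (hBZ : ∀ r x s, ‖B r x s‖ ≤ Z s) (hAZ : ∀ x s, ‖A x s‖ ≤ Z s)
    (hinc : ∀ r x s, ‖B (r + 1) x s - B r x s‖ ≤ d r * euclLen s)
    (hfin : ∀ r, (Set.range fun x => (B r x, B (r + 1) x)).Finite)
    (hcard : ∀ r, Real.log (Set.range fun x => (B r x, B (r + 1) x)).ncard ≤ M r)
    (hlast : ∀ x s, √(Fintype.card J) * ‖A x s - B L x s‖ ≤ τ * euclLen s)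
    (a b : J → ℝ) (ha : ∀ j, |a j| ≤ 1) (hb : ∀ j, |b j| ≤ 1) :
    𝔼 w : (J → ℤˣ) × (J → ℤˣ),
        (⨆ x, |inner ℝ (A x (a * signVec w.1)) (A x (b * signVec w.2))|) ^ q
      ≤ (∑ r ∈ range L, 16 * d r * √(q + M r) + τ) ^ q *
        𝔼 w : (J → ℤˣ) × (J → ℤˣ), (Z (a * signVec w.1) + Z (b * signVec w.2)) ^ q := by
  have hZ0 : ∀ s, 0 ≤ Z s := fun s => (norm_nonneg _).trans (hAZ (Classical.arbitrary T) s)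
  set K := 𝔼 w : (J → ℤˣ) × (J → ℤˣ), (Z (a * signVec w.1) + Z (b * signVec w.2)) ^ q with hK
  let P : ℕ → Set (((J → ℝ) →ₗ[ℝ] H) × ((J → ℝ) →ₗ[ℝ] H)) :=
    fun r => Set.range fun x => (B r x, B (r + 1) x)
  have hPfin : ∀ r, Finite (P r) := fun r => (hfin r).to_subtype
  have hPne : ∀ r, Nonempty (P r) := fun r =>
    ⟨⟨_, Set.mem_range_self (Classical.arbitrary T)⟩⟩
  let U : ℕ → (J → ℤˣ) × (J → ℤˣ) → ℝ := fun r w =>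
    ⨆ k : P r, |inner ℝ ((k.1.2 - k.1.1) (a * signVec w.1)) (k.1.2 (b * signVec w.2))|
  let W : ℕ → (J → ℤˣ) × (J → ℤˣ) → ℝ := fun r w =>
    ⨆ k : P r, |inner ℝ ((k.1.2 - k.1.1) (b * signVec w.2)) (k.1.1 (a * signVec w.1))|
  have hU0 : ∀ r w, 0 ≤ U r w := fun r w => Real.iSup_nonneg fun k => abs_nonneg _
  have hW0 : ∀ r w, 0 ≤ W r w := fun r w => Real.iSup_nonneg fun k => abs_nonneg _
  have hPinc : ∀ r (k : P r) s, ‖(k.1.2 - k.1.1) s‖ ≤ d r * euclLen s := by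
    rintro r ⟨_, x, rfl⟩ s
    exact hinc r x s
  have hcard' : ∀ r, Real.log (Nat.card (P r)) ≤ M r := hcard
  have hU : ∀ r, 𝔼 w, U r w ^ q ≤ (8 * d r * √(q + M r)) ^ q * K := by
    intro r
    have h1 : ∀ y : J → ℤˣ, 𝔼 x, U r (x, y) ^ q
        ≤ (8 * d r * √(q + M r)) ^ q * Z (b * signVec y) ^ q := fun y =>
      expect_max_inner_pow_le (fun k : P r => k.1.2 - k.1.1) (fun k => k.1.2 (b * signVec y))
        (d r) (Z (b * signVec y)) (M r) (hd r).le (hZ0 _) (hPinc r)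
        (by rintro ⟨_, x, rfl⟩; exact hBZ _ _ _) (hcard' r) a ha q hq
    rw [expect_prod, Finset.expect_comm]
    refine (Finset.expect_le_expect fun y _ => h1 y).trans ?_
    rw [← Finset.mul_expect]
    refine mul_le_mul_of_nonneg_left ?_ (by have := hd r; positivity)
    rw [hK, expect_prod, Finset.expect_comm]
    refine Finset.expect_le_expect fun y _ => Finset.le_expect Finset.univ_nonempty fun x _ => ?_
    exact pow_le_pow_left₀ (hZ0 _) (by linarith [hZ0 (a * signVec x)]) q
  have hW : ∀ r, 𝔼 w, W r w ^ q ≤ (8 * d r * √(q + M r)) ^ q * K := by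
    intro r
    have h1 : ∀ x : J → ℤˣ, 𝔼 y, W r (x, y) ^ q
        ≤ (8 * d r * √(q + M r)) ^ q * Z (a * signVec x) ^ q := fun x =>
      expect_max_inner_pow_le (fun k : P r => k.1.2 - k.1.1) (fun k => k.1.1 (a * signVec x))
        (d r) (Z (a * signVec x)) (M r) (hd r).le (hZ0 _) (hPinc r)
        (by rintro ⟨_, x, rfl⟩; exact hBZ _ _ _) (hcard' r) b hb q hq
    rw [expect_prod]
    refine (Finset.expect_le_expect fun y _ => h1 y).trans ?_
    rw [← Finset.mul_expect]
    refine mul_le_mul_of_nonneg_left ?_ (by have := hd r; positivity)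
    rw [hK, expect_prod]
    refine Finset.expect_le_expect fun y _ => Finset.le_expect Finset.univ_nonempty fun x _ => ?_
    exact pow_le_pow_left₀ (hZ0 _) (by linarith [hZ0 (b * signVec x)]) q
  let f : ℕ → (J → ℤˣ) × (J → ℤˣ) → ℝ := fun r w =>
    if r < L then U r w + W r w else τ * (Z (a * signVec w.1) + Z (b * signVec w.2))
  let c : ℕ → ℝ := fun r => if r < L then 16 * d r * √(q + M r) else τ
  have hq0 : (1 : ℝ) ≤ q := by exact_mod_cast hq
  have hmain := expect_sum_pow_le (range (L + 1)) ⟨0, by simp⟩ f c K q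
    (fun r w => by
      have := hZ0 (a * signVec w.1); have := hZ0 (b * signVec w.2)
      have := hU0 r w; have := hW0 r w
      simp only [f]; split_ifs <;> positivity)
    (fun r => by
      have := hd r; have := hM0 r
      simp only [c]; split_ifs
      · have : 0 < √(q + M r) := Real.sqrt_pos.2 (by linarith)
        positivity
      · exact hτ)
    (fun r _ => by
      simp only [f, c]
      split_ifs with hr
      · have h2 : ∀ w, (U r w + W r w) ^ q ≤ 2 ^ (q - 1) * (U r w ^ q + W r w ^ q) :=
          fun w => add_pow_le (hU0 r w) (hW0 r w) q
        refine (Finset.expect_le_expect fun w _ => h2 w).trans ?_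
        rw [← Finset.mul_expect, Finset.expect_add_distrib]
        have h3 : (16 * d r * √(q + M r)) ^ q = 2 ^ (q - 1) * (2 * (8 * d r * √(q + M r)) ^ q) := by
          obtain ⟨q', rfl⟩ : ∃ q', q = q' + 1 := ⟨q - 1, by omega⟩
          have : 16 * d r * √(((q' + 1 : ℕ) : ℝ) + M r)
            = 2 * (8 * d r * √(((q' + 1 : ℕ) : ℝ) + M r)) := by ring
          rw [this, mul_pow 2, pow_succ 2, Nat.add_sub_cancel, mul_assoc]
        rw [h3, mul_assoc]
        refine mul_le_mul_of_nonneg_left ?_ (by positivity)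
        linarith [hU r, hW r]
      · simp only [mul_pow]
        rw [← Finset.mul_expect])
  have hc : ∑ r ∈ range (L + 1), c r = ∑ r ∈ range L, 16 * d r * √(q + M r) + τ := by
    rw [Finset.sum_range_succ]
    congr 1
    · exact Finset.sum_congr rfl fun r hr => if_pos (Finset.mem_range.1 hr)
    · simp [c]
  rw [hc] at hmain
  refine le_trans (Finset.expect_le_expect fun w _ => ?_) hmain
  refine pow_le_pow_left₀ (Real.iSup_nonneg fun _ => abs_nonneg _) ?_ q
  refine ciSup_le fun x => ?_
  rw [Finset.sum_range_succ]
  have hfL : f L w = τ * (Z (a * signVec w.1) + Z (b * signVec w.2)) := by simp [f]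
  have hfr : ∑ r ∈ range L, f r w = ∑ r ∈ range L, (U r w + W r w) :=
    Finset.sum_congr rfl fun r hr => if_pos (Finset.mem_range.1 hr)
  rw [hfL, hfr]
  set u := a * signVec w.1 with hu
  set v := b * signVec w.2 with hv
  have hlen : ∀ (c : J → ℝ) (θ : J → ℤˣ), (∀ j, |c j| ≤ 1) →
      ‖A x (c * signVec θ) - B L x (c * signVec θ)‖ ≤ τ := by
    intro c θ hc
    rcases isEmpty_or_nonempty J with hJ | hJ
    · have h0 : c * signVec θ = 0 := Subsingleton.elim _ _
      rw [h0]; simpa using hτ.le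
    · have hpos : 0 < √(Fintype.card J : ℝ) :=
        Real.sqrt_pos.2 (by exact_mod_cast Fintype.card_pos)
      have h1 := hlast x (c * signVec θ)
      have h2 := euclLen_mul_le hc (signVec θ)
      rw [euclLen_signVec] at h2
      have h3 := h1.trans (mul_le_mul_of_nonneg_left h2 hτ.le)
      rw [mul_comm τ] at h3
      exact le_of_mul_le_mul_left h3 hpos
  have hlast' : |inner ℝ (A x u) (A x v) - inner ℝ (B L x u) (B L x v)| ≤ τ * (Z u + Z v) := by
    have h1 : inner ℝ (A x u) (A x v) - inner ℝ (B L x u) (B L x v)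
        = inner ℝ (A x u - B L x u) (A x v) + inner ℝ (B L x u) (A x v - B L x v) := by
      rw [inner_sub_left, inner_sub_right]; ring
    rw [h1]
    refine (abs_add_le _ _).trans ?_
    have h2 : |inner ℝ (A x u - B L x u) (A x v)| ≤ τ * Z v :=
      (abs_real_inner_le_norm _ _).trans
        (mul_le_mul (hlen a w.1 ha) (hAZ x v) (norm_nonneg _) hτ.le)
    have h3 : |inner ℝ (B L x u) (A x v - B L x v)| ≤ Z u * τ :=
      (abs_real_inner_le_norm _ _).trans
        (mul_le_mul (hBZ L x u) (hlen b w.2 hb) (norm_nonneg _) (hZ0 u))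
    linarith
  have htel : inner ℝ (B L x u) (B L x v)
      = ∑ r ∈ range L, (inner ℝ (B (r + 1) x u) (B (r + 1) x v) - inner ℝ (B r x u) (B r x v)) := by
    rw [Finset.sum_range_sub (fun r => inner ℝ (B r x u) (B r x v)) L]
    simp [hB0]
  have hstep : ∀ r, |inner ℝ (B (r + 1) x u) (B (r + 1) x v) - inner ℝ (B r x u) (B r x v)|
      ≤ U r w + W r w := by
    intro r
    have h1 : inner ℝ (B (r + 1) x u) (B (r + 1) x v) - inner ℝ (B r x u) (B r x v)
        = inner ℝ ((B (r + 1) x - B r x) u) (B (r + 1) x v)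
          + inner ℝ ((B (r + 1) x - B r x) v) (B r x u) := by
      rw [LinearMap.sub_apply, LinearMap.sub_apply, inner_sub_left, inner_sub_left,
        real_inner_comm (B r x u) (B (r + 1) x v), real_inner_comm (B r x u) (B r x v)]
      ring
    rw [h1]
    refine (abs_add_le _ _).trans (add_le_add ?_ ?_)
    · exact le_ciSup (f := fun k : P r =>
        |inner ℝ ((k.1.2 - k.1.1) (a * signVec w.1)) (k.1.2 (b * signVec w.2))|)
        (Set.finite_range _).bddAbove ⟨_, Set.mem_range_self x⟩
    · exact le_ciSup (f := fun k : P r =>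
        |inner ℝ ((k.1.2 - k.1.1) (b * signVec w.2)) (k.1.1 (a * signVec w.1))|)
        (Set.finite_range _).bddAbove ⟨_, Set.mem_range_self x⟩
  have hBL : |inner ℝ (B L x u) (B L x v)| ≤ ∑ r ∈ range L, (U r w + W r w) := by
    rw [htel]
    exact (Finset.abs_sum_le_sum_abs _ _).trans (Finset.sum_le_sum fun r _ => hstep r)
  have htri := abs_add_le (inner ℝ (A x u) (A x v) - inner ℝ (B L x u) (B L x v))
    (inner ℝ (B L x u) (B L x v))
  rw [sub_add_cancel] at htri
  linarith

/-- The sign vector that agrees with `θ` where `η = 1` and with `θ'` elsewhere. -/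
def mixSigns {J : Type*} (η θ θ' : J → ℤˣ) : J → ℤˣ := fun j => if η j = 1 then θ j else θ' j

lemma expect_mixSigns {J : Type*} [Fintype J] [DecidableEq J] (η : J → ℤˣ)
    (f : (J → ℤˣ) → ℝ) :
    𝔼 w : (J → ℤˣ) × (J → ℤˣ), f (mixSigns η w.1 w.2) = 𝔼 s, f s := by
  have hinv : Function.Involutive fun w : (J → ℤˣ) × (J → ℤˣ) =>
      (mixSigns η w.1 w.2, mixSigns η w.2 w.1) := by
    rintro ⟨θ, θ'⟩
    ext j <;> by_cases h : η j = 1 <;> simp [mixSigns, h]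
  rw [Fintype.expect_equiv hinv.toPerm (fun w => f (mixSigns η w.1 w.2)) (fun w => f w.1)
    (fun w => rfl), expect_prod]
  simp

lemma expect_mul_right_signs {J : Type*} [Fintype J] [DecidableEq J] (η : J → ℤˣ)
    (f : (J → ℤˣ) → ℝ) : 𝔼 s, f (s * η) = 𝔼 s, f s :=
  Fintype.expect_equiv (Equiv.mulRight η) _ _ fun _ => rfl

lemma expect_mul_left_signs {J : Type*} [Fintype J] [DecidableEq J] (η : J → ℤˣ)
    (f : (J → ℤˣ) → ℝ) : 𝔼 s, f (η * s) = 𝔼 s, f s :=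
  Fintype.expect_equiv (Equiv.mulLeft η) _ _ fun _ => rfl

lemma expect_signVec_mul {J : Type*} [Fintype J] [DecidableEq J] (i j : J) :
    𝔼 s : J → ℤˣ, signVec s i * signVec s j = if i = j then 1 else 0 := by
  split_ifs with h
  · subst h
    simp [← sq, signVec_sq]
  · have h1 := expect_mul_right_signs (Pi.mulSingle i (-1))
      (fun s : J → ℤˣ => signVec s i * signVec s j)
    have h2 : ∀ s : J → ℤˣ, signVec (s * Pi.mulSingle i (-1)) i *
        signVec (s * Pi.mulSingle i (-1)) j = -(signVec s i * signVec s j) := by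
      intro s
      simp [signVec, Pi.mulSingle_eq_of_ne (Ne.symm h)]
    simp only [h2, Finset.expect_neg_distrib] at h1
    linarith

lemma expect_norm_sq_signVec {J H : Type*} [Fintype J] [DecidableEq J] [NormedAddCommGroup H]
    [InnerProductSpace ℝ H] (B : (J → ℝ) →ₗ[ℝ] H) :
    𝔼 s : J → ℤˣ, ‖B (signVec s)‖ ^ 2 = ∑ j, ‖B (Pi.single j 1)‖ ^ 2 := by
  have h1 : ∀ s : J → ℤˣ, ‖B (signVec s)‖ ^ 2 = ∑ i, ∑ j, (signVec s i * signVec s j) *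
      inner ℝ (B (Pi.single i 1)) (B (Pi.single j 1)) := by
    intro s
    rw [← real_inner_self_eq_norm_sq, linearMap_eq_sum_single B (signVec s), sum_inner]
    refine Finset.sum_congr rfl fun i _ => ?_
    rw [inner_sum]
    refine Finset.sum_congr rfl fun j _ => ?_
    rw [real_inner_smul_left, real_inner_smul_right]
    ring
  simp only [h1]
  rw [Finset.expect_sum_comm]
  refine Finset.sum_congr rfl fun i _ => ?_
  rw [Finset.expect_sum_comm]
  simp only [← Finset.expect_mul, expect_signVec_mul]
  simp

/-- Moments of a quadratic Rademacher process are controlled by its decoupled version. -/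
lemma expect_quadratic_pow_le {T J H : Type*} [Nonempty T] [Fintype J] [DecidableEq J]
    [NormedAddCommGroup H] [InnerProductSpace ℝ H] (A : T → (J → ℝ) →ₗ[ℝ] H) (q : ℕ)
    (hq : 1 ≤ q) (δ β : ℝ) (hA : ∀ x s, ‖A x s‖ ≤ δ * euclLen s) (hβ : 0 ≤ β)
    (hdec : ∀ a b : J → ℝ, (∀ j, |a j| ≤ 1) → (∀ j, |b j| ≤ 1) →
      𝔼 w : (J → ℤˣ) × (J → ℤˣ),
        (⨆ x, |inner ℝ (A x (a * signVec w.1)) (A x (b * signVec w.2))|) ^ q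
      ≤ β ^ q * 𝔼 w : (J → ℤˣ) × (J → ℤˣ),
        ((⨆ x, ‖A x (a * signVec w.1)‖) + ⨆ x, ‖A x (b * signVec w.2)‖) ^ q) :
    𝔼 s : J → ℤˣ, (⨆ x, |‖A x (signVec s)‖ ^ 2 - ∑ j, ‖A x (Pi.single j 1)‖ ^ 2|) ^ q
      ≤ (8 * β) ^ q * 𝔼 s : J → ℤˣ, (⨆ x, ‖A x (signVec s)‖) ^ q := by
  set Z : (J → ℝ) → ℝ := fun u => ⨆ x, ‖A x u‖ with hZ
  have hZ0 : ∀ u, 0 ≤ Z u := fun u => Real.iSup_nonneg fun _ => norm_nonneg _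
  have hAZ : ∀ x u, ‖A x u‖ ≤ Z u := fun x u =>
    le_ciSup (f := fun x => ‖A x u‖) ⟨δ * euclLen u, by rintro _ ⟨x, rfl⟩; exact hA x u⟩ x
  let D : (J → ℤˣ) → (J → ℤˣ) → ℝ := fun s η =>
    ⨆ x, |‖A x (signVec s)‖ ^ 2 - ‖A x (signVec (s * η))‖ ^ 2|
  have hD0 : ∀ s η, 0 ≤ D s η := fun s η => Real.iSup_nonneg fun _ => abs_nonneg _
  have hDle : ∀ s η x, |‖A x (signVec s)‖ ^ 2 - ‖A x (signVec (s * η))‖ ^ 2| ≤ D s η := by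
    intro s η x
    refine le_ciSup (f := fun x => |‖A x (signVec s)‖ ^ 2 - ‖A x (signVec (s * η))‖ ^ 2|)
      ⟨Z (signVec s) ^ 2 + Z (signVec (s * η)) ^ 2, ?_⟩ x
    rintro _ ⟨x, rfl⟩
    have h1 := pow_le_pow_left₀ (norm_nonneg _) (hAZ x (signVec s)) 2
    have h2 := pow_le_pow_left₀ (norm_nonneg _) (hAZ x (signVec (s * η))) 2
    have h3 := sq_nonneg ‖A x (signVec s)‖
    have h4 := sq_nonneg ‖A x (signVec (s * η))‖
    simp only
    rw [abs_le]; constructor <;> linarith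
  have hY : ∀ s : J → ℤˣ, (⨆ x, |‖A x (signVec s)‖ ^ 2 - ∑ j, ‖A x (Pi.single j 1)‖ ^ 2|) ^ q
      ≤ 𝔼 η, D s η ^ q := by
    intro s
    refine le_trans (pow_le_pow_left₀ (Real.iSup_nonneg fun _ => abs_nonneg _)
      (ciSup_le fun x => ?_) q) (expect_pow_le_expect_pow _ (hD0 s) q)
    have h1 : ‖A x (signVec s)‖ ^ 2 - ∑ j, ‖A x (Pi.single j 1)‖ ^ 2
        = 𝔼 η, (‖A x (signVec s)‖ ^ 2 - ‖A x (signVec (s * η))‖ ^ 2) := by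
      rw [Finset.expect_sub_distrib, Fintype.expect_const,
        expect_mul_left_signs s (fun t => ‖A x (signVec t)‖ ^ 2), expect_norm_sq_signVec]
    rw [h1]
    exact (Finset.abs_expect_le _ _).trans (Finset.expect_le_expect fun η _ => hDle s η x)
  have hη : ∀ η, 𝔼 s, D s η ^ q ≤ (8 * β) ^ q * 𝔼 s : J → ℤˣ, Z (signVec s) ^ q := by
    intro η
    let a : J → ℝ := fun j => (1 + signVec η j) / 2
    let b : J → ℝ := fun j => (1 - signVec η j) / 2
    have ha : ∀ j, |a j| ≤ 1 := by
      intro j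
      rcases Int.units_eq_one_or (η j) with h | h <;> simp [a, signVec, h]
    have hb : ∀ j, |b j| ≤ 1 := by
      intro j
      rcases Int.units_eq_one_or (η j) with h | h <;> simp [b, signVec, h]
    have hmix : ∀ w : (J → ℤˣ) × (J → ℤˣ), signVec (mixSigns η w.1 w.2)
        = a * signVec w.1 + b * signVec w.2 := by
      intro w; ext j
      rcases Int.units_eq_one_or (η j) with h | h <;> simp [a, b, signVec, mixSigns, h]
    have hmix' : ∀ w : (J → ℤˣ) × (J → ℤˣ), signVec (mixSigns η w.1 w.2 * η)
        = a * signVec w.1 - b * signVec w.2 := by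
      intro w; ext j
      rcases Int.units_eq_one_or (η j) with h | h <;> simp [a, b, signVec, mixSigns, h]
    have hDw : ∀ w : (J → ℤˣ) × (J → ℤˣ), D (mixSigns η w.1 w.2) η ^ q
        = 4 ^ q * (⨆ x, |inner ℝ (A x (a * signVec w.1)) (A x (b * signVec w.2))|) ^ q := by
      intro w
      rw [← mul_pow, Real.mul_iSup_of_nonneg (by norm_num)]
      congr 1
      refine iSup_congr fun x => ?_
      rw [hmix, hmix', map_add, map_sub, norm_add_sq_real, norm_sub_sq_real,
        ← abs_of_pos (show (0 : ℝ) < 4 by norm_num), ← abs_mul]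
      congr 1; ring
    have hhalf : ∀ u v w : J → ℝ, 2 • w = u + v → 2 * Z w ≤ Z u + Z v := by
      intro u v w huv
      rw [hZ]
      simp only
      rw [Real.mul_iSup_of_nonneg (by norm_num)]
      refine ciSup_le fun x => ?_
      have h1 : 2 * ‖A x w‖ = ‖A x u + A x v‖ := by
        rw [← map_add, ← huv, map_nsmul, ← Nat.cast_smul_eq_nsmul ℝ, norm_smul]; simp
      rw [h1]
      exact (norm_add_le _ _).trans (add_le_add (hAZ x u) (hAZ x v))
    have hZw : ∀ w : (J → ℤˣ) × (J → ℤˣ), (Z (a * signVec w.1) + Z (b * signVec w.2)) ^ q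
        ≤ (Z (signVec (mixSigns η w.1 w.2)) + Z (signVec (mixSigns η w.1 w.2 * η))) ^ q := by
      intro w
      refine pow_le_pow_left₀ (add_nonneg (hZ0 _) (hZ0 _)) ?_ q
      have h1 := hhalf (signVec (mixSigns η w.1 w.2)) (signVec (mixSigns η w.1 w.2 * η))
        (a * signVec w.1) (by rw [hmix, hmix', two_smul]; abel)
      have h2 := hhalf (signVec (mixSigns η w.1 w.2)) (-signVec (mixSigns η w.1 w.2 * η))
        (b * signVec w.2) (by rw [hmix, hmix', two_smul]; abel)
      have h3 : Z (-signVec (mixSigns η w.1 w.2 * η)) = Z (signVec (mixSigns η w.1 w.2 * η)) := by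
        simp [hZ]
      linarith
    have hsum : 𝔼 s : J → ℤˣ, (Z (signVec s) + Z (signVec (s * η))) ^ q
        ≤ 2 ^ q * 𝔼 s : J → ℤˣ, Z (signVec s) ^ q := by
      refine (Finset.expect_le_expect fun s _ => add_pow_le (hZ0 _) (hZ0 _) q).trans ?_
      rw [← Finset.mul_expect, Finset.expect_add_distrib,
        expect_mul_right_signs η (fun t => Z (signVec t) ^ q), ← two_mul, ← mul_assoc,
        ← pow_succ, Nat.sub_add_cancel hq]
    calc 𝔼 s, D s η ^ q = 𝔼 w : (J → ℤˣ) × (J → ℤˣ), D (mixSigns η w.1 w.2) η ^ q :=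
          (expect_mixSigns η fun s => D s η ^ q).symm
      _ = 4 ^ q * 𝔼 w : (J → ℤˣ) × (J → ℤˣ),
          (⨆ x, |inner ℝ (A x (a * signVec w.1)) (A x (b * signVec w.2))|) ^ q := by
          rw [Finset.mul_expect]; exact Finset.expect_congr rfl fun w _ => hDw w
      _ ≤ 4 ^ q * (β ^ q * 𝔼 w : (J → ℤˣ) × (J → ℤˣ),
          (Z (a * signVec w.1) + Z (b * signVec w.2)) ^ q) := by
          gcongr; exact hdec a b ha hb
      _ ≤ 4 ^ q * (β ^ q * 𝔼 w : (J → ℤˣ) × (J → ℤˣ),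
          (Z (signVec (mixSigns η w.1 w.2)) + Z (signVec (mixSigns η w.1 w.2 * η))) ^ q) := by
          refine mul_le_mul_of_nonneg_left (mul_le_mul_of_nonneg_left
            (Finset.expect_le_expect fun w _ => hZw w) (by positivity)) (by positivity)
      _ = 4 ^ q * (β ^ q * 𝔼 s : J → ℤˣ, (Z (signVec s) + Z (signVec (s * η))) ^ q) := by
          rw [expect_mixSigns η fun s => (Z (signVec s) + Z (signVec (s * η))) ^ q]
      _ ≤ 4 ^ q * (β ^ q * (2 ^ q * 𝔼 s : J → ℤˣ, Z (signVec s) ^ q)) := by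
          gcongr
      _ = (8 * β) ^ q * 𝔼 s : J → ℤˣ, Z (signVec s) ^ q := by
          have : (8 : ℝ) * β = 4 * β * 2 := by ring
          rw [this, mul_pow, mul_pow]; ring
  calc 𝔼 s : J → ℤˣ, (⨆ x, |‖A x (signVec s)‖ ^ 2 - ∑ j, ‖A x (Pi.single j 1)‖ ^ 2|) ^ q
      ≤ 𝔼 s, 𝔼 η, D s η ^ q := Finset.expect_le_expect fun s _ => hY s
    _ = 𝔼 η, 𝔼 s, D s η ^ q := Finset.expect_comm _ _ _
    _ ≤ _ := Finset.expect_le Finset.univ_nonempty fun η _ => hη η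

/-- If `Z ^ 2 ≤ 2 + Y` and the moments of `Y` are controlled by those of `Z`, then `Y` is small
with high probability. -/
lemma tail_of_self_bounding {Ω : Type*} [Fintype Ω] [Nonempty Ω] (Y Z : Ω → ℝ)
    (hY : ∀ ω, 0 ≤ Y ω) (hZ : ∀ ω, 0 ≤ Z ω) (hZY : ∀ ω, Z ω ^ 2 ≤ 2 + Y ω) (q : ℕ) (hq : 1 ≤ q)
    (B α : ℝ) (hB : 0 ≤ B) (hα : 0 < α) (hα1 : α ≤ 1) (hBα : 36 * B ≤ α)
    (h : 𝔼 ω, Y ω ^ q ≤ B ^ q * 𝔼 ω, Z ω ^ q) (p : Ω → Prop) [DecidablePred p]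
    (hp : ∀ ω, p ω → α ≤ Y ω) :
    𝔼 ω, (if p ω then (1 : ℝ) else 0) ≤ Real.exp (-2 * q) := by
  set m := 𝔼 ω, Y ω ^ q with hm
  have hm0 : 0 ≤ m := Finset.expect_nonneg fun ω _ => pow_nonneg (hY ω) q
  set t := (2 * B) ^ q with ht
  have ht0 : 0 ≤ t := by positivity
  have ht1 : t ≤ 1 := pow_le_one₀ (by positivity) (by linarith)
  have hZq : (𝔼 ω, Z ω ^ q) ^ 2 ≤ 4 ^ q * (1 + m) := by
    refine (expect_pow_le_expect_pow _ (fun ω => pow_nonneg (hZ ω) q) 2).trans ?_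
    have h1 : ∀ ω, (Z ω ^ q) ^ 2 ≤ 4 ^ q * (1 + Y ω ^ q) := by
      intro ω
      rw [← pow_mul, mul_comm, pow_mul]
      refine (pow_le_pow_left₀ (sq_nonneg _) (hZY ω) q).trans ?_
      refine (add_pow_le (by norm_num) (hY ω) q).trans ?_
      have h2 : (2 : ℝ) ^ (q - 1) ≤ 2 ^ q := pow_le_pow_right₀ (by norm_num) (by omega)
      have h3 : (1 : ℝ) ≤ 2 ^ q := one_le_pow₀ (by norm_num)
      have h4 : 0 ≤ Y ω ^ q := pow_nonneg (hY ω) q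
      have h5 : (4 : ℝ) ^ q = 2 ^ q * 2 ^ q := by rw [← mul_pow]; norm_num
      rw [h5, mul_assoc]
      refine mul_le_mul h2 ?_ (by positivity) (by positivity)
      nlinarith
    refine (Finset.expect_le_expect fun ω _ => h1 ω).trans ?_
    rw [← Finset.mul_expect, Finset.expect_add_distrib, Fintype.expect_const]
  have hm2 : m ^ 2 ≤ t ^ 2 * (1 + m) := by
    calc m ^ 2 ≤ (B ^ q * 𝔼 ω, Z ω ^ q) ^ 2 := pow_le_pow_left₀ hm0 h 2
      _ = (B ^ q) ^ 2 * (𝔼 ω, Z ω ^ q) ^ 2 := by ring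
      _ ≤ (B ^ q) ^ 2 * (4 ^ q * (1 + m)) := by gcongr
      _ = t ^ 2 * (1 + m) := by
        have : (4 : ℝ) ^ q = (2 ^ q) ^ 2 := by rw [← pow_mul, mul_comm, pow_mul]; norm_num
        rw [ht, mul_pow, this]; ring
  have hmt : m ≤ 2 * t := by
    by_contra hlt
    push Not at hlt
    have h1 : t * t * m ≤ t * m := by
      have := mul_le_of_le_one_left ht0 ht1
      exact mul_le_mul_of_nonneg_right this hm0
    nlinarith
  have hmB : m ≤ (4 * B) ^ q := by
    have h1 : (2 : ℝ) ≤ 2 ^ q := by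
      calc (2 : ℝ) = 2 ^ 1 := by norm_num
        _ ≤ 2 ^ q := pow_le_pow_right₀ (by norm_num) hq
    calc m ≤ 2 * t := hmt
      _ ≤ 2 ^ q * t := by gcongr
      _ = (4 * B) ^ q := by rw [ht, ← mul_pow]; ring_nf
  have hmarkov : α ^ q * 𝔼 ω, (if p ω then (1 : ℝ) else 0) ≤ m := by
    rw [Finset.mul_expect]
    refine Finset.expect_le_expect fun ω _ => ?_
    split_ifs with hpω
    · rw [mul_one]; exact pow_le_pow_left₀ hα.le (hp ω hpω) q
    · rw [mul_zero]; exact pow_nonneg (hY ω) q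
  have he : Real.exp 2 ≤ 9 := by
    have h1 := Real.exp_one_lt_d9
    have h2 : Real.exp 2 = Real.exp 1 ^ 2 := by rw [← Real.exp_nat_mul]; norm_num
    rw [h2]
    have h3 := Real.exp_pos 1
    nlinarith
  have hfin : (4 * B) ^ q ≤ α ^ q * Real.exp (-2 * q) := by
    have h1 : Real.exp (-2 * q) = Real.exp (-2) ^ q := by
      rw [← Real.exp_nat_mul]; ring_nf
    rw [h1, ← mul_pow]
    refine pow_le_pow_left₀ (by positivity) ?_ q
    rw [Real.exp_neg, ← div_eq_mul_inv, le_div_iff₀ (Real.exp_pos _)]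
    nlinarith
  exact le_of_mul_le_mul_left ((hmarkov.trans hmB).trans hfin) (by positivity)

lemma sum_chain_weights_le (L q : ℕ) (δ κ : ℝ) (hδ : 0 ≤ δ) (hκ : 0 ≤ κ) :
    ∑ r ∈ range L, 16 * (3 * δ / 2 ^ r) * √(q + 5 * κ ^ 2 * 4 ^ r)
      ≤ δ * (96 * √q + 144 * κ * L) := by
  have h1 : ∀ r : ℕ, 16 * (3 * δ / 2 ^ r) * √(q + 5 * κ ^ 2 * 4 ^ r)
      ≤ 48 * δ * √q * (1 / 2) ^ r + 144 * δ * κ := by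
    intro r
    have h2 : √(q + 5 * κ ^ 2 * 4 ^ r) ≤ √q + 3 * κ * 2 ^ r := by
      have hs := Real.sqrt_nonneg (q : ℝ)
      rw [Real.sqrt_le_left (by positivity)]
      have h3 := Real.sq_sqrt (Nat.cast_nonneg (α := ℝ) q)
      have h4 : (4 : ℝ) ^ r = (2 ^ r) ^ 2 := by rw [← pow_mul, mul_comm, pow_mul]; norm_num
      rw [h4]
      have h5 : 0 ≤ √q * (κ * 2 ^ r) := by positivity
      nlinarith [sq_nonneg (κ * 2 ^ r)]
    calc 16 * (3 * δ / 2 ^ r) * √(q + 5 * κ ^ 2 * 4 ^ r)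
        ≤ 16 * (3 * δ / 2 ^ r) * (√q + 3 * κ * 2 ^ r) := by gcongr
      _ = 48 * δ * √q * (1 / 2) ^ r + 144 * δ * κ := by
          rw [one_div, inv_pow]; field_simp; ring
  refine (Finset.sum_le_sum fun r _ => h1 r).trans ?_
  rw [Finset.sum_add_distrib, ← Finset.mul_sum, Finset.sum_const, Finset.card_range, nsmul_eq_mul]
  have h6 : ∑ r ∈ range L, ((1 : ℝ) / 2) ^ r ≤ 2 := sum_geometric_two_le L
  have h7 : 48 * δ * √q * ∑ r ∈ range L, ((1 : ℝ) / 2) ^ r ≤ 48 * δ * √q * 2 := by gcongr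
  linarith

/-- Tail bound for the deviation of a quadratic Rademacher process from its mean, under an entropy
condition at dyadic scales. -/
theorem quadratic_process_tail {T J H : Type*} [Nonempty T] [Fintype J] [DecidableEq J]
    [NormedAddCommGroup H] [InnerProductSpace ℝ H] (A : T → (J → ℝ) →ₗ[ℝ] H) (π : ℕ → T → T)
    (L q : ℕ) (hq : 1 ≤ q) (δ κ α : ℝ) (hδ : 0 < δ) (hκ : 0 ≤ κ) (hα : 0 < α) (hα1 : α ≤ 1)
    (hA : ∀ x s, ‖A x s‖ ≤ δ * euclLen s)
    (hπ : ∀ r x s, ‖A x s - A (π r x) s‖ ≤ 2 * δ / 2 ^ r * euclLen s)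
    (hfin : ∀ r, (Set.range (π r)).Finite)
    (hcard : ∀ r, Real.log (Set.range (π r)).ncard ≤ κ ^ 2 * 4 ^ r)
    (hL : √(Fintype.card J) ≤ 2 ^ L)
    (hF : ∀ x, ∑ j, ‖A x (Pi.single j 1)‖ ^ 2 ≤ 2)
    (hβ : 288 * (δ * (98 * √q + 144 * κ * L)) ≤ α)
    (p : (J → ℤˣ) → Prop) [DecidablePred p]
    (hp : ∀ s, p s → ∃ x, α ≤ |‖A x (signVec s)‖ ^ 2 - ∑ j, ‖A x (Pi.single j 1)‖ ^ 2|) :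
    𝔼 s, (if p s then (1 : ℝ) else 0) ≤ Real.exp (-2 * q) := by
  let B : ℕ → T → (J → ℝ) →ₗ[ℝ] H := fun r x => if r = 0 then 0 else A (π r x)
  have hZle : ∀ x s, ‖A x s‖ ≤ ⨆ x, ‖A x s‖ := fun x s =>
    le_ciSup (f := fun x => ‖A x s‖) ⟨δ * euclLen s, by rintro _ ⟨x, rfl⟩; exact hA x s⟩ x
  have hZ0 : ∀ s, 0 ≤ ⨆ x, ‖A x s‖ := fun s => Real.iSup_nonneg fun _ => norm_nonneg _
  have hBfin : ∀ r, (Set.range (B r)).Finite := by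
    intro r
    by_cases hr : r = 0
    · exact (Set.finite_singleton 0).subset (by rintro _ ⟨x, rfl⟩; simp [B, hr])
    · refine ((hfin r).image A).subset ?_
      rintro _ ⟨x, rfl⟩
      simp only [B, hr, if_false]
      exact Set.mem_image_of_mem _ (Set.mem_range_self x)
  have hBcard : ∀ r, Real.log (Set.range (B r)).ncard ≤ κ ^ 2 * 4 ^ r := by
    intro r
    by_cases hr : r = 0
    · have h1 : (Set.range (B r)).ncard ≤ 1 := by
        rw [Set.ncard_le_one (hBfin r)]
        rintro _ ⟨x, rfl⟩ _ ⟨y, rfl⟩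
        simp [B, hr]
      have h2 : Real.log (Set.range (B r)).ncard ≤ 0 :=
        Real.log_nonpos (Nat.cast_nonneg _) (by exact_mod_cast h1)
      exact h2.trans (by positivity)
    · refine le_trans (Real.log_le_log ?_ ?_) (hcard r)
      · have := (Set.ncard_pos (hBfin r)).2 (Set.range_nonempty _)
        exact_mod_cast this
      · have h1 : Set.range (B r) = A '' Set.range (π r) := by
          rw [← Set.range_comp]
          simp only [B, hr, if_false]; rfl
        rw [h1]
        exact_mod_cast Set.ncard_image_le (hfin r)
  have hsub : ∀ r, (Set.range fun x => (B r x, B (r + 1) x))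
      ⊆ Set.range (B r) ×ˢ Set.range (B (r + 1)) := by
    rintro r _ ⟨x, rfl⟩
    exact ⟨Set.mem_range_self x, Set.mem_range_self x⟩
  have hPfin : ∀ r, (Set.range fun x => (B r x, B (r + 1) x)).Finite := fun r =>
    ((hBfin r).prod (hBfin (r + 1))).subset (hsub r)
  have hdec := fun (a b : J → ℝ) (ha : ∀ j, |a j| ≤ 1) (hb : ∀ j, |b j| ≤ 1) =>
    expect_decoupled_pow_le A B L q hq (fun r => 3 * δ / 2 ^ r) (fun r => 5 * κ ^ 2 * 4 ^ r)
      (fun r => by positivity) (fun r => by positivity) (fun s => ⨆ x, ‖A x s‖) (2 * δ)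
      (by positivity) (fun x => by simp [B])
      (fun r x s => by
        by_cases hr : r = 0
        · simp [B, hr, hZ0]
        · simpa [B, hr] using hZle (π r x) s)
      hZle
      (fun r x s => by
        have hl := euclLen_nonneg s
        by_cases hr : r = 0
        · subst hr
          have h1 := hA (π 1 x) s
          simp only [B, zero_add, one_ne_zero, if_false, if_true, LinearMap.zero_apply, sub_zero,
            pow_zero, div_one]
          nlinarith
        · simp only [B, hr, if_false, Nat.succ_ne_zero]
          have h1 := hπ r x s
          have h2 := hπ (r + 1) x s
          have h3 : A (π (r + 1) x) s - A (π r x) s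
              = (A x s - A (π r x) s) - (A x s - A (π (r + 1) x) s) := by abel
          rw [h3]
          refine (norm_sub_le _ _).trans ((add_le_add h1 h2).trans (le_of_eq ?_))
          rw [pow_succ]; field_simp; ring)
      hPfin
      (fun r => by
        have h1 : (Set.range fun x => (B r x, B (r + 1) x)).ncard
            ≤ (Set.range (B r)).ncard * (Set.range (B (r + 1))).ncard := by
          rw [← Set.ncard_prod]
          exact Set.ncard_le_ncard (hsub r) ((hBfin r).prod (hBfin (r + 1)))
        have hpos : ∀ r, (Set.range (B r)).ncard ≠ 0 := fun r =>
          ((Set.ncard_pos (hBfin r)).2 (Set.range_nonempty _)).ne'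
        have h2 : 0 < (Set.range fun x => (B r x, B (r + 1) x)).ncard :=
          (Set.ncard_pos (hPfin r)).2 (Set.range_nonempty _)
        have h3 : Real.log (Set.range fun x => (B r x, B (r + 1) x)).ncard
            ≤ Real.log ((Set.range (B r)).ncard * (Set.range (B (r + 1))).ncard : ℝ) :=
          Real.log_le_log (by exact_mod_cast h2) (by exact_mod_cast h1)
        rw [Real.log_mul (by exact_mod_cast hpos r) (by exact_mod_cast hpos (r + 1))] at h3
        have h4 := hBcard r
        have h5 := hBcard (r + 1)
        rw [pow_succ (4 : ℝ)] at h5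
        linarith)
      (fun x s => by
        have hl := euclLen_nonneg s
        by_cases hr : L = 0
        · subst hr
          simp only [B, if_true, LinearMap.zero_apply, sub_zero]
          have h1 := mul_le_mul hL (hA x s) (norm_nonneg _) (by norm_num)
          simp only [pow_zero, one_mul] at h1
          nlinarith
        · simp only [B, hr, if_false]
          have h1 := mul_le_mul hL (hπ L x s) (norm_nonneg _) (by positivity)
          refine h1.trans (le_of_eq ?_)
          field_simp)
      a b ha hb
  set β := δ * (98 * √q + 144 * κ * L) with hβdef
  have hβ0 : 0 ≤ β := by positivity
  have hle : ∑ r ∈ range L, 16 * (3 * δ / 2 ^ r) * √(q + 5 * κ ^ 2 * 4 ^ r) + 2 * δ ≤ β := by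
    have h1 := sum_chain_weights_le L q δ κ hδ.le hκ
    have h2 : 1 ≤ √(q : ℝ) := by
      rw [Real.one_le_sqrt]; exact_mod_cast hq
    rw [hβdef]
    nlinarith
  have hquad := expect_quadratic_pow_le A q hq δ β hA hβ0 fun a b ha hb =>
    (hdec a b ha hb).trans (mul_le_mul_of_nonneg_right
      (pow_le_pow_left₀ (add_nonneg (Finset.sum_nonneg fun r _ => by positivity) (by positivity))
        hle q)
      (Finset.expect_nonneg fun w _ => pow_nonneg (add_nonneg (hZ0 _) (hZ0 _)) q))
  have hdev : ∀ (s : J → ℤˣ) x, |‖A x (signVec s)‖ ^ 2 - ∑ j, ‖A x (Pi.single j 1)‖ ^ 2|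
      ≤ ⨆ x, |‖A x (signVec s)‖ ^ 2 - ∑ j, ‖A x (Pi.single j 1)‖ ^ 2| := by
    intro s x
    refine le_ciSup (f := fun x => |‖A x (signVec s)‖ ^ 2 - ∑ j, ‖A x (Pi.single j 1)‖ ^ 2|)
      ⟨(δ * euclLen (signVec s)) ^ 2 + 2, ?_⟩ x
    rintro _ ⟨x, rfl⟩
    have h1 := pow_le_pow_left₀ (norm_nonneg _) (hA x (signVec s)) 2
    have h2 := hF x
    have h3 : 0 ≤ ∑ j, ‖A x (Pi.single j 1)‖ ^ 2 := Finset.sum_nonneg fun _ _ => sq_nonneg _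
    have h4 := sq_nonneg ‖A x (signVec s)‖
    simp only
    rw [abs_le]; constructor <;> linarith
  refine tail_of_self_bounding
    (fun s : J → ℤˣ => ⨆ x, |‖A x (signVec s)‖ ^ 2 - ∑ j, ‖A x (Pi.single j 1)‖ ^ 2|)
    (fun s => ⨆ x, ‖A x (signVec s)‖) (fun s => Real.iSup_nonneg fun _ => abs_nonneg _)
    (fun s => hZ0 _) (fun s => ?_) q hq (8 * β) α (by positivity) hα hα1 (by linarith) hquad p
    (fun s hs => ?_)
  · have hY0 : 0 ≤ ⨆ x, |‖A x (signVec s)‖ ^ 2 - ∑ j, ‖A x (Pi.single j 1)‖ ^ 2| :=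
      Real.iSup_nonneg fun _ => abs_nonneg _
    refine (Real.le_sqrt (hZ0 _) (by linarith)).1 (ciSup_le fun x => ?_)
    rw [Real.le_sqrt (norm_nonneg _) (by linarith)]
    have h1 := hdev s x
    have h2 := hF x
    have h3 := le_abs_self (‖A x (signVec s)‖ ^ 2 - ∑ j, ‖A x (Pi.single j 1)‖ ^ 2)
    linarith
  · obtain ⟨x, hx⟩ := hp s hs
    exact hx.trans (hdev s x)

/-- Exponential moment of a bounded centred function under a discrete probability weight. -/
theorem sum_weight_exp_le {Z : Type*} [Fintype Z] (p X : Z → ℝ) (hp0 : ∀ z, 0 ≤ p z)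
    (hp1 : ∑ z, p z = 1) (hX : ∀ z, |X z| ≤ 2) (hmean : ∑ z, p z * X z = 0) (s : ℝ) :
    ∑ z, p z * Real.exp (s * X z) ≤ Real.exp (2 * s ^ 2) := by
  have hz : ∀ z, Real.exp (s * X z) ≤ Real.cosh (2 * s) + X z / 2 * Real.sinh (2 * s) := by
    intro z
    have h1 : |X z / 2| ≤ 1 := by
      rw [abs_div, abs_of_pos (two_pos : (0 : ℝ) < 2)]
      linarith [hX z]
    have := Real.exp_mul_le_cosh_add_mul_sinh h1 (2 * s)
    convert this using 2
    ring
  calc ∑ z, p z * Real.exp (s * X z)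
      ≤ ∑ z, p z * (Real.cosh (2 * s) + X z / 2 * Real.sinh (2 * s)) :=
        sum_le_sum fun z _ => mul_le_mul_of_nonneg_left (hz z) (hp0 z)
    _ = (∑ z, p z) * Real.cosh (2 * s) + (∑ z, p z * X z) * (Real.sinh (2 * s) / 2) := by
        rw [sum_mul, sum_mul, ← sum_add_distrib]
        exact sum_congr rfl fun z _ => by ring
    _ = Real.cosh (2 * s) := by rw [hp1, hmean]; ring
    _ ≤ Real.exp ((2 * s) ^ 2 / 2) := Real.cosh_le_exp_half_sq _
    _ = Real.exp (2 * s ^ 2) := by congr 1; ring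

/-- Maurey's empirical method: a weighted mean of finitely many bounded functions is uniformly
approximated by an unweighted mean over few sample points. -/
theorem exists_empirical_approx {Z F : Type*} [Fintype Z] [Fintype F] (p : Z → ℝ)
    (hp0 : ∀ z, 0 ≤ p z) (hp1 : ∑ z, p z = 1) (f : F → Z → ℝ) (hf : ∀ a z, |f a z| ≤ 1)
    {t : ℝ} (ht : 0 < t) {K : ℕ} (hK0 : 0 < K)
    (hK : 8 * Real.log (2 * Fintype.card F) ≤ K * t ^ 2) :
    ∃ z : Fin K → Z, ∀ a, |(∑ i, f a (z i)) / K - ∑ z, p z * f a z| ≤ t := by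
  set m : F → ℝ := fun a => ∑ z, p z * f a z with hm
  have hmle : ∀ a, |m a| ≤ 1 := by
    intro a
    calc |m a| ≤ ∑ z, |p z * f a z| := abs_sum_le_sum_abs _ _
      _ ≤ ∑ z, p z := sum_le_sum fun z _ => by
          rw [abs_mul, abs_of_nonneg (hp0 z)]
          exact mul_le_of_le_one_right (hp0 z) (hf a z)
      _ = 1 := hp1
  set X : F → Z → ℝ := fun a z => f a z - m a with hX
  have hXle : ∀ a z, |X a z| ≤ 2 := fun a z => by
    have := abs_sub (f a z) (m a)
    linarith [hf a z, hmle a]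
  have hXmean : ∀ a, ∑ z, p z * X a z = 0 := by
    intro a
    simp only [hX, mul_sub, sum_sub_distrib, ← sum_mul, hp1, one_mul]
    exact sub_self _
  set s := t / 4 with hs
  have hs0 : 0 < s := by positivity
  have hmgf : ∀ (a : F) (c : ℝ), c ^ 2 = s ^ 2 →
      ∑ z : Fin K → Z, (∏ i, p (z i)) * Real.exp (c * ∑ i, X a (z i))
        ≤ Real.exp (2 * s ^ 2) ^ K := by
    intro a c hc
    calc ∑ z : Fin K → Z, (∏ i, p (z i)) * Real.exp (c * ∑ i, X a (z i))
        = ∑ z : Fin K → Z, ∏ i, (p (z i) * Real.exp (c * X a (z i))) := by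
          refine sum_congr rfl fun z _ => ?_
          rw [prod_mul_distrib, ← Real.exp_sum, mul_sum]
      _ = (∑ z, p z * Real.exp (c * X a z)) ^ K :=
          (Fintype.sum_pow (fun z => p z * Real.exp (c * X a z)) K).symm
      _ ≤ Real.exp (2 * s ^ 2) ^ K := by
          refine pow_le_pow_left₀ (sum_nonneg fun z _ =>
            mul_nonneg (hp0 z) (Real.exp_pos _).le) ?_ K
          rw [← hc]
          exact sum_weight_exp_le p (X a) hp0 hp1 (hXle a) (hXmean a) c
  have htot : ∑ z : Fin K → Z, ∏ i, p (z i) = 1 := by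
    rw [← Fintype.sum_pow, hp1, one_pow]
  set E := Real.exp (2 * s ^ 2) ^ K with hE
  obtain ⟨z, hz⟩ : ∃ z : Fin K → Z, ∑ a, (Real.exp (s * ∑ i, X a (z i)) +
      Real.exp (-s * ∑ i, X a (z i))) ≤ Fintype.card F * (2 * E) := by
    by_contra! hcon
    have hle : ∑ z : Fin K → Z, (∏ i, p (z i)) * ∑ a, (Real.exp (s * ∑ i, X a (z i)) +
        Real.exp (-s * ∑ i, X a (z i))) ≤ Fintype.card F * (2 * E) := by
      calc _ = ∑ a, ((∑ z : Fin K → Z, (∏ i, p (z i)) * Real.exp (s * ∑ i, X a (z i))) +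
            ∑ z : Fin K → Z, (∏ i, p (z i)) * Real.exp (-s * ∑ i, X a (z i))) := by
            simp_rw [mul_sum, mul_add]
            rw [sum_comm]
            simp_rw [sum_add_distrib]
        _ ≤ ∑ a : F, 2 * E := sum_le_sum fun a _ => by
            linarith [hmgf a s rfl, hmgf a (-s) (neg_sq s)]
        _ = _ := by simp
    have hlt : ∑ z : Fin K → Z, (∏ i, p (z i)) * (Fintype.card F * (2 * E)) <
        ∑ z : Fin K → Z, (∏ i, p (z i)) * ∑ a, (Real.exp (s * ∑ i, X a (z i)) +
        Real.exp (-s * ∑ i, X a (z i))) := by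
      refine sum_lt_sum (fun z _ => mul_le_mul_of_nonneg_left (hcon z).le
        (prod_nonneg fun i _ => hp0 _)) ?_
      obtain ⟨z, -, hz⟩ := exists_ne_zero_of_sum_ne_zero (htot.trans_ne one_ne_zero)
      exact ⟨z, mem_univ _, mul_lt_mul_of_pos_left (hcon z)
        (lt_of_le_of_ne (prod_nonneg fun i _ => hp0 _) hz.symm)⟩
    rw [← sum_mul, htot, one_mul] at hlt
    exact absurd hle (not_le.2 hlt)
  refine ⟨z, fun a => ?_⟩
  have hKpos : (0 : ℝ) < K := by exact_mod_cast hK0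
  have hFpos : (0 : ℝ) < Fintype.card F := by exact_mod_cast Fintype.card_pos_iff.2 ⟨a⟩
  have hElog : Real.log (Fintype.card F * (2 * E)) =
      Real.log (2 * Fintype.card F) + 2 * s ^ 2 * K := by
    have hEeq : E = Real.exp (2 * s ^ 2 * K) := by
      rw [hE, ← Real.exp_nat_mul]; ring_nf
    rw [show (Fintype.card F : ℝ) * (2 * E) = 2 * Fintype.card F * E by ring,
      Real.log_mul (by positivity) (by rw [hEeq]; positivity), hEeq, Real.log_exp]
  have hsum : ∀ c, c = s ∨ c = -s → c * ∑ i, X a (z i) ≤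
      Real.log (2 * Fintype.card F) + 2 * s ^ 2 * K := by
    intro c hc
    rw [← hElog]
    refine (Real.le_log_iff_exp_le (by positivity)).2 (le_trans ?_ hz)
    refine le_trans ?_ (single_le_sum (f := fun a => Real.exp (s * ∑ i, X a (z i)) +
      Real.exp (-s * ∑ i, X a (z i))) (fun b _ => by positivity) (mem_univ a))
    rcases hc with rfl | rfl
    · exact le_add_of_nonneg_right (Real.exp_pos _).le
    · exact le_add_of_nonneg_left (Real.exp_pos _).le
  have hXs : (∑ i, f a (z i)) / K - m a = (∑ i, X a (z i)) / K := by
    simp only [hX, sum_sub_distrib, sum_const, card_univ, Fintype.card_fin, nsmul_eq_mul]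
    field_simp
  change |(∑ i, f a (z i)) / K - m a| ≤ t
  rw [hXs, abs_div, abs_of_pos hKpos, div_le_iff₀ hKpos, abs_le']
  have hfin : ∀ y : ℝ, s * y ≤ Real.log (2 * Fintype.card F) + 2 * s ^ 2 * K → y ≤ t * K := by
    intro y hy
    have : s * y ≤ s * (t * K) := by
      refine hy.trans ?_
      rw [hs]
      nlinarith [hK]
    exact le_of_mul_le_mul_left this hs0
  exact ⟨hfin _ (hsum s (Or.inl rfl)), hfin _ (by
    have := hsum (-s) (Or.inr rfl)
    linarith)⟩

/-- The Fourier coefficient of a real function on a finite abelian group. -/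
def charSum {G : Type*} [AddCommGroup G] [Fintype G] (x : G → ℝ) (ψ : AddChar G ℂ) : ℂ :=
  ∑ g, (x g : ℂ) * ψ g

section Fourier

variable {G : Type*} [AddCommGroup G] [Fintype G]

theorem charSum_sub (x y : G → ℝ) (ψ : AddChar G ℂ) :
    charSum (fun g => x g - y g) ψ = charSum x ψ - charSum y ψ := by
  simp [charSum, sub_mul, sum_sub_distrib]

theorem norm_charSum_le (x : G → ℝ) (ψ : AddChar G ℂ) : ‖charSum x ψ‖ ≤ ∑ g, |x g| := by
  refine (norm_sum_le _ _).trans (sum_le_sum fun g _ => ?_)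
  simp [AddChar.norm_apply]

theorem charSum_comp_neg (x : G → ℝ) (ψ : AddChar G ℂ) :
    charSum (fun g => x (-g)) ψ = charSum x (ψ⁻¹) := by
  simp only [charSum, AddChar.inv_apply]
  exact Fintype.sum_equiv (Equiv.neg G) _ _ fun g => by simp

theorem charSum_convolution (x y : G → ℝ) (ψ : AddChar G ℂ) :
    charSum (fun g => ∑ u, x (g - u) * y u) ψ = charSum x ψ * charSum y ψ := by
  simp only [charSum, Complex.ofReal_sum, Complex.ofReal_mul, sum_mul, mul_sum]
  rw [sum_comm]
  refine sum_congr rfl fun u _ => ?_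
  refine Fintype.sum_equiv (Equiv.subRight u) _ _ fun g => ?_
  have : ψ g = ψ (g - u) * ψ u := by rw [← AddChar.map_add_eq_mul, sub_add_cancel]
  simp only [Equiv.subRight_apply]
  rw [this]
  ring

/-- Parseval's identity. -/
theorem sum_norm_charSum_sq [DecidableEq G] (x : G → ℝ) :
    ∑ ψ : AddChar G ℂ, ‖charSum x ψ‖ ^ 2 = Fintype.card G * ∑ g, x g ^ 2 := by
  have h : ∀ ψ : AddChar G ℂ, ((‖charSum x ψ‖ ^ 2 : ℝ) : ℂ) =
      ∑ g, ∑ h, (x g * x h : ℂ) * ψ (g - h) := by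
    intro ψ
    rw [Complex.ofReal_pow, ← Complex.mul_conj']
    simp only [charSum, map_sum, map_mul, Complex.conj_ofReal, sum_mul_sum]
    refine sum_congr rfl fun g _ => sum_congr rfl fun h _ => ?_
    rw [sub_eq_add_neg, AddChar.map_add_eq_mul, AddChar.map_neg_eq_conj]
    ring
  have : ((∑ ψ : AddChar G ℂ, ‖charSum x ψ‖ ^ 2 : ℝ) : ℂ) =
      ((Fintype.card G * ∑ g, x g ^ 2 : ℝ) : ℂ) := by
    rw [Complex.ofReal_sum]
    simp_rw [h]
    rw [sum_comm]
    simp_rw [sum_comm (s := (univ : Finset (AddChar G ℂ))), ← mul_sum,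
      AddChar.sum_apply_eq_ite, sub_eq_zero]
    push_cast
    rw [mul_sum]
    refine sum_congr rfl fun g _ => ?_
    simp
    ring
  exact_mod_cast this

/-- A convolution operator is bounded by the largest Fourier coefficient of its kernel. -/
theorem sum_convolution_sq_le [DecidableEq G] (x y : G → ℝ) {M : ℝ}
    (hM : ∀ ψ, ‖charSum x ψ‖ ≤ M) :
    ∑ g, (∑ u, x (g - u) * y u) ^ 2 ≤ M ^ 2 * ∑ u, y u ^ 2 := by
  have hcard : (0 : ℝ) < Fintype.card G := by exact_mod_cast Fintype.card_pos
  refine le_of_mul_le_mul_left ?_ hcard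
  rw [← sum_norm_charSum_sq, mul_left_comm, ← sum_norm_charSum_sq, mul_sum]
  refine sum_le_sum fun ψ _ => ?_
  rw [charSum_convolution, norm_mul, mul_pow]
  exact mul_le_mul_of_nonneg_right (pow_le_pow_left₀ (norm_nonneg _) (hM ψ) 2) (by positivity)

/-- The transposed convolution operator obeys the same bound. -/
theorem sum_correlation_sq_le [DecidableEq G] (x y : G → ℝ) {M : ℝ}
    (hM : ∀ ψ, ‖charSum x ψ‖ ≤ M) :
    ∑ u, (∑ g, x (g - u) * y g) ^ 2 ≤ M ^ 2 * ∑ g, y g ^ 2 := by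
  have := sum_convolution_sq_le (fun g => x (-g)) y (M := M)
    (fun ψ => by rw [charSum_comp_neg]; exact hM _)
  simpa using this

/-- Fourier coefficients of a function in the `ℓ¹` ball are uniformly approximated by signed
averages of few point evaluations. -/
theorem exists_charSum_code (w : G → ℝ) (hw : ∑ g, |w g| ≤ 1) (r : ℕ) {K : ℕ} (hK0 : 0 < K)
    (hK : 32 * 4 ^ r * Real.log (4 * Fintype.card G) ≤ K) :
    ∃ z : Fin K → G × ℤˣ, ∀ ψ : AddChar G ℂ,
      ‖(∑ i, (((z i).2 : ℤ) : ℂ) * ψ (z i).1) / K - charSum w ψ‖ ≤ 1 / 2 ^ r := by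
  classical
  have hcard : (0 : ℝ) < Fintype.card G := by exact_mod_cast Fintype.card_pos
  set c := (1 - ∑ g, |w g|) / (2 * Fintype.card G) with hc
  have hc0 : 0 ≤ c := div_nonneg (by linarith) (by positivity)
  set p : G × ℤˣ → ℝ := fun a => (|w a.1| + ((a.2 : ℤ) : ℝ) * w a.1) / 2 + c with hp
  have hunits : ∀ F : ℤˣ → ℝ, ∑ u, F u = F 1 + F (-1) := fun F => by
    rw [show (univ : Finset ℤˣ) = {1, -1} from rfl, sum_pair (by decide)]
  have hp0 : ∀ a, 0 ≤ p a := by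
    rintro ⟨g, u⟩
    rcases Int.units_eq_one_or u with rfl | rfl
    · have := neg_abs_le (w g)
      simp only [hp, Units.val_one, Int.cast_one, one_mul]
      linarith
    · have := le_abs_self (w g)
      simp only [hp, Units.val_neg, Units.val_one, Int.cast_neg, Int.cast_one]
      linarith
  have hp1 : ∑ a, p a = 1 := by
    rw [Fintype.sum_prod_type]
    simp only [hunits, hp, Units.val_one, Units.val_neg, Int.cast_one, Int.cast_neg]
    have : ∀ g, (|w g| + 1 * w g) / 2 + c + ((|w g| + -1 * w g) / 2 + c) = |w g| + 2 * c :=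
      fun g => by ring
    simp_rw [this, sum_add_distrib]
    rw [sum_const, card_univ, nsmul_eq_mul, hc]
    field_simp
    ring
  have hpmean : ∀ F : G → ℝ, ∑ a, p a * (((a.2 : ℤ) : ℝ) * F a.1) = ∑ g, w g * F g := by
    intro F
    rw [Fintype.sum_prod_type]
    refine sum_congr rfl fun g _ => ?_
    simp only [hunits, hp, Units.val_one, Units.val_neg, Int.cast_one, Int.cast_neg]
    ring
  have hu : ∀ u : ℤˣ, |((u : ℤ) : ℝ)| = 1 := fun u => by
    rcases Int.units_eq_one_or u with rfl | rfl <;> simp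
  let part : AddChar G ℂ × Bool → G → ℝ := fun a g => if a.2 then (a.1 g).re else (a.1 g).im
  have hpart : ∀ a g, |part a g| ≤ 1 := by
    rintro ⟨ψ, b⟩ g
    have h1 : ‖ψ g‖ = 1 := AddChar.norm_apply _ _
    cases b
    · exact (Complex.abs_im_le_norm _).trans h1.le
    · exact (Complex.abs_re_le_norm _).trans h1.le
  obtain ⟨z, hz⟩ := exists_empirical_approx (F := AddChar G ℂ × Bool) p hp0 hp1
    (fun a b => ((b.2 : ℤ) : ℝ) * part a b.1)
    (fun a b => by rw [abs_mul, hu, one_mul]; exact hpart a b.1)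
    (t := 1 / 2 ^ r / 2) (by positivity) hK0 (by
      rw [Fintype.card_prod, AddChar.card_eq, Fintype.card_bool]
      have h4 : (4 : ℝ) ^ r = 2 ^ r * 2 ^ r := by rw [← mul_pow]; norm_num
      rw [h4] at hK
      have h2 : (0 : ℝ) < 2 ^ r := by positivity
      rw [div_div, div_pow, ← mul_div_assoc, le_div_iff₀ (by positivity)]
      push_cast
      rw [show (2 : ℝ) * (Fintype.card G * 2) = 4 * Fintype.card G by ring]
      nlinarith)
  refine ⟨z, fun ψ => ?_⟩
  have hre := hz (ψ, true)
  have him := hz (ψ, false)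
  rw [hpmean] at hre him
  refine (Complex.norm_le_abs_re_add_abs_im _).trans ?_
  have e1 : ((∑ i, (((z i).2 : ℤ) : ℂ) * ψ (z i).1) / K - charSum w ψ).re =
      (∑ i, (((z i).2 : ℤ) : ℝ) * part (ψ, true) (z i).1) / K -
        ∑ g, w g * part (ψ, true) g := by
    simp [charSum, part, Complex.div_natCast_re, Complex.re_sum]
  have e2 : ((∑ i, (((z i).2 : ℤ) : ℂ) * ψ (z i).1) / K - charSum w ψ).im =
      (∑ i, (((z i).2 : ℤ) : ℝ) * part (ψ, false) (z i).1) / K -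
        ∑ g, w g * part (ψ, false) g := by
    simp [charSum, part, Complex.div_natCast_im, Complex.im_sum]
  rw [e1, e2]
  linarith

/-- A family of functions in an `ℓ¹` ball has small nets for the uniform norm of Fourier
coefficients. -/
theorem exists_charSum_net {T : Type*} [Nonempty T] (x : T → G → ℝ) {ρ : ℝ} (hρ : 0 < ρ)
    (hx : ∀ a, ∑ g, |x a g| ≤ ρ) (r : ℕ) :
    ∃ π : T → T, (Set.range π).Finite ∧
      Real.log (Set.range π).ncard ≤ (6 * Real.log (4 * Fintype.card G)) ^ 2 * 4 ^ r ∧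
      ∀ a ψ, ‖charSum (x a) ψ - charSum (x (π a)) ψ‖ ≤ 2 * ρ / 2 ^ r := by
  classical
  have hcard : (1 : ℝ) ≤ Fintype.card G := by exact_mod_cast Fintype.card_pos
  set l := Real.log (4 * Fintype.card G) with hl
  have hl1 : 1 ≤ l := by
    refine (Real.le_log_iff_exp_le (by positivity)).2 ?_
    linarith [Real.exp_one_lt_d9]
  set K := ⌈32 * 4 ^ r * l⌉₊ with hK
  have hr1 : (1 : ℝ) ≤ 4 ^ r := one_le_pow₀ (by norm_num)
  have hKl : 32 * 4 ^ r * l ≤ K := Nat.le_ceil _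
  have hKu : (K : ℝ) ≤ 32 * 4 ^ r * l + 1 := (Nat.ceil_lt_add_one (by positivity)).le
  have hK0 : 0 < K := Nat.ceil_pos.2 (by positivity)
  have hcode : ∀ a, ∃ z : Fin K → G × ℤˣ, ∀ ψ : AddChar G ℂ,
      ‖(∑ i, (((z i).2 : ℤ) : ℂ) * ψ (z i).1) / K - charSum (fun g => x a g / ρ) ψ‖
        ≤ 1 / 2 ^ r := by
    intro a
    refine exists_charSum_code _ ?_ r hK0 hKl
    simp_rw [abs_div, abs_of_pos hρ, ← sum_div]
    exact div_le_one_of_le₀ (hx a) hρ.le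
  choose c hc using hcode
  have hscale : ∀ a ψ, charSum (x a) ψ = ρ * charSum (fun g => x a g / ρ) ψ := by
    intro a ψ
    simp only [charSum, mul_sum, Complex.ofReal_div]
    refine sum_congr rfl fun g _ => ?_
    have : (ρ : ℂ) ≠ 0 := by exact_mod_cast hρ.ne'
    field_simp
  let π : T → T := fun a => Function.invFun c (c a)
  have hπ : ∀ a, c (π a) = c a := fun a => Function.invFun_eq ⟨a, rfl⟩
  have hsub : Set.range π ⊆ Set.range (Function.invFun c) := by
    rintro _ ⟨a, rfl⟩
    exact ⟨c a, rfl⟩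
  have hfin : (Set.range (Function.invFun c)).Finite := Set.finite_range _
  refine ⟨π, hfin.subset hsub, ?_, fun a ψ => ?_⟩
  · have hn : (Set.range π).ncard ≤ (2 * Fintype.card G) ^ K := by
      refine (Set.ncard_le_ncard hsub hfin).trans ?_
      rw [← Set.image_univ]
      refine (Set.ncard_image_le Set.finite_univ).trans_eq ?_
      rw [Set.ncard_univ, Nat.card_eq_fintype_card, Fintype.card_fun, Fintype.card_prod,
        Fintype.card_fin, Fintype.card_units_int, mul_comm]
    have hpos : 0 < (Set.range π).ncard :=
      (Set.ncard_pos (hfin.subset hsub)).2 (Set.range_nonempty π)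
    calc Real.log (Set.range π).ncard ≤ Real.log ((2 * Fintype.card G : ℝ) ^ K) :=
          Real.log_le_log (by exact_mod_cast hpos) (by exact_mod_cast hn)
      _ = K * Real.log (2 * Fintype.card G) := Real.log_pow _ _
      _ ≤ (32 * 4 ^ r * l + 1) * l := by
          refine mul_le_mul hKu (Real.log_le_log (by positivity) (by linarith))
            (Real.log_nonneg (by linarith)) (by positivity)
      _ ≤ (6 * l) ^ 2 * 4 ^ r := by nlinarith [mul_le_mul hr1 hl1 zero_le_one (by positivity)]
  · rw [hscale, hscale, ← mul_sub, norm_mul, Complex.norm_real, Real.norm_of_nonneg hρ.le]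
    have h1 := hc a ψ
    have h2 := hc (π a) ψ
    rw [hπ] at h2
    rw [norm_sub_rev] at h1
    have := (norm_sub_le_norm_sub_add_norm_sub _ _ _).trans (add_le_add h1 h2)
    calc ρ * _ ≤ ρ * (1 / 2 ^ r + 1 / 2 ^ r) := mul_le_mul_of_nonneg_left this hρ.le
      _ = 2 * ρ / 2 ^ r := by ring

end Fourier

/-- A real matrix as a linear map into Euclidean space. -/
def euclMap {κ J : Type*} [Fintype J] (A : Matrix κ J ℝ) :
    (J → ℝ) →ₗ[ℝ] EuclideanSpace ℝ κ :=
  (WithLp.linearEquiv 2 ℝ (κ → ℝ)).symm.toLinearMap ∘ₗ A.mulVecLin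

theorem norm_euclMap_sq {κ J : Type*} [Fintype κ] [Fintype J] (A : Matrix κ J ℝ) (s : J → ℝ) :
    ‖euclMap A s‖ ^ 2 = ∑ i, (A *ᵥ s) i ^ 2 := by
  rw [EuclideanSpace.norm_sq_eq]
  simp [euclMap]

theorem euclMap_sub {κ J : Type*} [Fintype J] (A B : Matrix κ J ℝ) (s : J → ℝ) :
    euclMap A s - euclMap B s = euclMap (A - B) s := by
  simp [euclMap]

theorem sum_norm_euclMap_single_sq {κ J : Type*} [Fintype κ] [Fintype J] [DecidableEq J]
    (A : Matrix κ J ℝ) :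
    ∑ j, ‖euclMap A (Pi.single j 1)‖ ^ 2 = ∑ i, ∑ j, A i j ^ 2 := by
  simp_rw [norm_euclMap_sq, Matrix.mulVec_single_one, Matrix.col_apply]
  exact sum_comm

/-- Tail bound for the chaos generated by matrices depending additively on a function in an `ℓ¹`
ball, with operator norm controlled by Fourier coefficients. -/
theorem fourier_chaos_tail {G T J κ : Type*} [AddCommGroup G] [Fintype G] [Nonempty T]
    [Fintype J] [DecidableEq J] [Fintype κ] (x : T → G → ℝ) {R τ α : ℝ} (hR : 0 < R)
    (hτ : 0 < τ) (hα : 0 < α) (hα1 : α ≤ 1) (q : ℕ) (hq : 1 ≤ q)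
    (hx : ∀ a, ∑ g, |x a g| ≤ R) (M : (G → ℝ) → Matrix κ J ℝ)
    (hMsub : ∀ y z, M (fun g => y g - z g) = M y - M z)
    (hM : ∀ y N, (∀ ψ, ‖charSum y ψ‖ ≤ N) → ∀ s : J → ℝ,
      ∑ i, (M y *ᵥ s) i ^ 2 ≤ (τ * N) ^ 2 * ∑ j, s j ^ 2)
    (hF : ∀ a, ∑ i, ∑ j, M (x a) i j ^ 2 ≤ 2) (hJ : Fintype.card J ≤ Fintype.card G)
    (hβ : 288 * (τ * R * (98 * √q + 144 * (6 * Real.log (4 * Fintype.card G)) *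
      Nat.clog 2 (Fintype.card G))) ≤ α)
    (p : (J → ℤˣ) → Prop) [DecidablePred p]
    (hp : ∀ s, p s → ∃ a, α ≤ |∑ i, (M (x a) *ᵥ signVec s) i ^ 2 - ∑ i, ∑ j, M (x a) i j ^ 2|) :
    𝔼 s, (if p s then (1 : ℝ) else 0) ≤ Real.exp (-2 * q) := by
  have hcard : (1 : ℝ) ≤ Fintype.card G := by exact_mod_cast Fintype.card_pos
  have hbd : ∀ y N, 0 ≤ N → (∀ ψ, ‖charSum y ψ‖ ≤ N) → ∀ s : J → ℝ,
      ‖euclMap (M y) s‖ ≤ τ * N * euclLen s := by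
    intro y N hN hy s
    refine le_of_sq_le_sq ?_ (mul_nonneg (mul_nonneg hτ.le hN) (euclLen_nonneg s))
    rw [norm_euclMap_sq, mul_pow, euclLen_sq]
    exact hM y N hy s
  choose π hfin hlog hdist using fun r => exists_charSum_net x hR hx r
  refine quadratic_process_tail (fun a => euclMap (M (x a))) π (Nat.clog 2 (Fintype.card G)) q hq
    (τ * R) (6 * Real.log (4 * Fintype.card G)) α (by positivity)
    (mul_nonneg (by norm_num) (Real.log_nonneg (by linarith))) hα hα1 ?_ ?_ hfin hlog ?_ ?_ hβ p ?_
  · exact fun a s => hbd _ R hR.le (fun ψ => (norm_charSum_le _ _).trans (hx a)) s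
  · intro r a s
    rw [euclMap_sub, ← hMsub]
    refine (hbd _ (2 * R / 2 ^ r) (by positivity)
      (fun ψ => by rw [charSum_sub]; exact hdist r a ψ) s).trans_eq ?_
    ring
  · have h1 : (Fintype.card J : ℝ) ≤ 2 ^ Nat.clog 2 (Fintype.card G) := by
      exact_mod_cast hJ.trans (Nat.le_pow_clog (by norm_num) _)
    have h2 : (1 : ℝ) ≤ 2 ^ Nat.clog 2 (Fintype.card G) := one_le_pow₀ (by norm_num)
    rw [Real.sqrt_le_left (by positivity)]
    nlinarith
  · intro a
    rw [sum_norm_euclMap_single_sq]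
    exact hF a
  · intro s hs
    obtain ⟨a, ha⟩ := hp s hs
    refine ⟨a, ?_⟩
    rwa [sum_norm_euclMap_single_sq, norm_euclMap_sq]

section Blocks

variable {G I J : Type*} [AddCommGroup G] [DecidableEq I] [Fintype J]

/-- Block sums of products are bounded by the Cauchy-Schwarz inequality in each block. -/
theorem sum_block_sq_le [Fintype I] (b : J → I) (w y : J → ℝ) {ρ : ℝ}
    (hw : ∀ i, ∑ j, (if b j = i then w j ^ 2 else 0) ≤ ρ) :
    ∑ i, (∑ j, if b j = i then w j * y j else 0) ^ 2 ≤ ρ * ∑ j, y j ^ 2 := by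
  calc ∑ i, (∑ j, if b j = i then w j * y j else 0) ^ 2
      ≤ ∑ i, ρ * ∑ j, (if b j = i then y j ^ 2 else 0) := by
        refine sum_le_sum fun i _ => ?_
        have hwi := hw i
        simp only [← sum_filter] at hwi ⊢
        exact (sum_mul_sq_le_sq_mul_sq _ _ _).trans
          (mul_le_mul_of_nonneg_right hwi (sum_nonneg fun j _ => sq_nonneg _))
    _ = ρ * ∑ j, y j ^ 2 := by
        rw [← mul_sum, sum_comm]
        simp

/-- The matrix, depending on the function `x`, of the chaos in the row signs. -/
def rowMatrix (e : J → G) (b : J → I) (w : J → ℝ) (x : G → ℝ) : Matrix (I × G) J ℝ :=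
  Matrix.of fun a j => if b j = a.1 then w j * x (e j - a.2) else 0

/-- The matrix, depending on the function `x` and the row signs `η`, of the linear form in the
generating signs. -/
def genMatrix (e : J → G) (b : J → I) (w η : J → ℝ) (x : G → ℝ) : Matrix I G ℝ :=
  Matrix.of fun i u => ∑ j, if b j = i then w j * (η j * x (e j - u)) else 0

theorem sum_rowMatrix_mulVec_sq_le [Fintype G] [DecidableEq G] [Fintype I] {e : J → G}
    (he : Function.Injective e) (b : J → I) (w : J → ℝ) {ρ N : ℝ}
    (hw : ∀ i, ∑ j, (if b j = i then w j ^ 2 else 0) ≤ ρ) (x : G → ℝ)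
    (hx : ∀ ψ, ‖charSum x ψ‖ ≤ N) (s : J → ℝ) :
    ∑ a, (rowMatrix e b w x *ᵥ s) a ^ 2 ≤ ρ * N ^ 2 * ∑ j, s j ^ 2 := by
  have hwj : ∀ j, w j ^ 2 ≤ ρ := by
    intro j
    refine le_trans ?_ (hw (b j))
    refine le_trans ?_ (single_le_sum (f := fun l => if b l = b j then w l ^ 2 else 0)
      (fun l _ => by positivity) (mem_univ j))
    simp
  let c : I → G → ℝ := fun i => Function.extend e (fun j => if b j = i then w j * s j else 0) 0
  have hce : ∀ i j, c i (e j) = if b j = i then w j * s j else 0 := fun i j => he.extend_apply _ _ j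
  have hc0 : ∀ i g, g ∉ Set.range e → c i g = 0 := fun i g hg =>
    Function.extend_apply' _ _ _ fun ⟨j, hj⟩ => hg ⟨j, hj⟩
  have h1 : ∀ i u, (rowMatrix e b w x *ᵥ s) (i, u) = ∑ g, x (g - u) * c i g := by
    intro i u
    refine Fintype.sum_of_injective e he _ _ (fun g hg => by rw [hc0 i g hg, mul_zero]) fun j => ?_
    rw [hce]
    simp only [rowMatrix, Matrix.of_apply]
    split_ifs <;> ring
  have h2 : ∀ i, ∑ g, c i g ^ 2 = ∑ j, if b j = i then w j ^ 2 * s j ^ 2 else 0 := by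
    intro i
    refine (Fintype.sum_of_injective e he _ _ (fun g hg => by rw [hc0 i g hg]; ring)
      fun j => ?_).symm
    rw [hce]
    split_ifs <;> ring
  calc ∑ a, (rowMatrix e b w x *ᵥ s) a ^ 2
      = ∑ i, ∑ u, (∑ g, x (g - u) * c i g) ^ 2 := by
        rw [Fintype.sum_prod_type]
        simp_rw [h1]
    _ ≤ ∑ i, N ^ 2 * ∑ g, c i g ^ 2 := sum_le_sum fun i _ => sum_correlation_sq_le x (c i) hx
    _ = N ^ 2 * ∑ j, w j ^ 2 * s j ^ 2 := by
        simp_rw [h2]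
        rw [← mul_sum, sum_comm]
        simp
    _ ≤ N ^ 2 * ∑ j, ρ * s j ^ 2 := by
        refine mul_le_mul_of_nonneg_left (sum_le_sum fun j _ => ?_) (sq_nonneg N)
        exact mul_le_mul_of_nonneg_right (hwj j) (sq_nonneg _)
    _ = ρ * N ^ 2 * ∑ j, s j ^ 2 := by rw [← mul_sum]; ring

theorem sum_rowMatrix_sq [Fintype G] [Fintype I] (e : J → G) (b : J → I) (w : J → ℝ) (x : G → ℝ) :
    ∑ a, ∑ j, rowMatrix e b w x a j ^ 2 = (∑ j, w j ^ 2) * ∑ g, x g ^ 2 := by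
  have hshift : ∀ h : G, ∑ u, x (h - u) ^ 2 = ∑ g, x g ^ 2 := fun h =>
    Fintype.sum_equiv (Equiv.subLeft h) _ _ fun u => rfl
  rw [sum_comm, sum_mul]
  refine sum_congr rfl fun j _ => ?_
  rw [Fintype.sum_prod_type, sum_comm, ← hshift (e j), mul_sum]
  refine sum_congr rfl fun u _ => ?_
  simp only [rowMatrix, Matrix.of_apply, ite_pow]
  simp [mul_pow]

theorem genMatrix_apply (e : J → G) (b : J → I) (w η : J → ℝ) (x : G → ℝ) (i : I) (u : G) :
    genMatrix e b w η x i u = (rowMatrix e b w x *ᵥ η) (i, u) := by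
  simp only [genMatrix, rowMatrix, Matrix.mulVec, dotProduct, Matrix.of_apply, ite_mul, zero_mul]
  exact sum_congr rfl fun j _ => by split_ifs <;> ring

theorem genMatrix_mulVec [Fintype G] (e : J → G) (b : J → I) (w η : J → ℝ) (x s : G → ℝ) (i : I) :
    (genMatrix e b w η x *ᵥ s) i =
      ∑ j, if b j = i then w j * (η j * ∑ t, s (e j - t) * x t) else 0 := by
  simp only [genMatrix, Matrix.mulVec, dotProduct, Matrix.of_apply, sum_mul]
  rw [sum_comm]
  refine sum_congr rfl fun j _ => ?_
  split_ifs
  · rw [mul_sum, mul_sum]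
    refine Fintype.sum_equiv (Equiv.subLeft (e j)) _ _ fun u => ?_
    simp only [Equiv.subLeft_apply, sub_sub_cancel]
    ring
  · simp

theorem sum_genMatrix_mulVec_sq_le [Fintype G] [DecidableEq G] [Fintype I] {e : J → G}
    (he : Function.Injective e) (b : J → I) (w η : J → ℝ) (hη : ∀ j, η j ^ 2 = 1)
    {ρ N : ℝ} (hρ : 0 ≤ ρ)
    (hw : ∀ i, ∑ j, (if b j = i then w j ^ 2 else 0) ≤ ρ) (x : G → ℝ)
    (hx : ∀ ψ, ‖charSum x ψ‖ ≤ N) (s : G → ℝ) :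
    ∑ i, (genMatrix e b w η x *ᵥ s) i ^ 2 ≤ ρ * N ^ 2 * ∑ u, s u ^ 2 := by
  let h : G → ℝ := fun g => ∑ t, s (g - t) * x t
  have hh : ∀ g, h g = ∑ u, x (g - u) * s u := fun g =>
    Fintype.sum_equiv (Equiv.subLeft g) _ _ fun t => by
      simp only [Equiv.subLeft_apply, sub_sub_cancel]
      ring
  calc ∑ i, (genMatrix e b w η x *ᵥ s) i ^ 2
      = ∑ i, (∑ j, if b j = i then w j * (η j * h (e j)) else 0) ^ 2 := by
        simp_rw [genMatrix_mulVec]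
        rfl
    _ ≤ ρ * ∑ j, (η j * h (e j)) ^ 2 := sum_block_sq_le b w _ hw
    _ = ρ * ∑ j, h (e j) ^ 2 := by simp_rw [mul_pow, hη, one_mul]
    _ ≤ ρ * ∑ g, h g ^ 2 := by
        refine mul_le_mul_of_nonneg_left ?_ hρ
        rw [← sum_image (s := univ) (g := e) (f := fun g => h g ^ 2) he.injOn]
        exact sum_le_univ_sum_of_nonneg fun g => sq_nonneg _
    _ ≤ ρ * (N ^ 2 * ∑ u, s u ^ 2) := by
        refine mul_le_mul_of_nonneg_left ?_ hρ
        simp_rw [hh]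
        exact sum_convolution_sq_le x s hx
    _ = ρ * N ^ 2 * ∑ u, s u ^ 2 := by ring

open Classical in
/-- Uniform concentration of the energy of sign-randomised block measurements of circular
convolutions. -/
theorem randomized_convolution_tail [Fintype G] [DecidableEq G] [Fintype I] [DecidableEq J]
    {T : Type*} [Nonempty T] {e : J → G}
    (he : Function.Injective e) (b : J → I) (w : J → ℝ) {ρ R α : ℝ} (hρ : 0 < ρ) (hR : 0 < R)
    (hα : 0 < α) (hα1 : α ≤ 1) (hw : ∀ i, ∑ j, (if b j = i then w j ^ 2 else 0) ≤ ρ)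
    (hw1 : ∑ j, w j ^ 2 = 1) (x : T → G → ℝ) (hx : ∀ a, ∑ g, |x a g| ≤ R)
    (hx2 : ∀ a, ∑ g, x a g ^ 2 = 1) (q : ℕ) (hq : 1 ≤ q)
    (hβ : 288 * (√ρ * R * (98 * √q + 144 * (6 * Real.log (4 * Fintype.card G)) *
      Nat.clog 2 (Fintype.card G))) ≤ α / 2) :
    𝔼 ω : (G → ℤˣ) × (J → ℤˣ), (if ∃ a, α < |∑ i, (∑ j, if b j = i then w j *
      (signVec ω.2 j * ∑ t, signVec ω.1 (e j - t) * x a t) else 0) ^ 2 - 1| then (1 : ℝ) else 0)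
      ≤ 2 * Real.exp (-2 * q) := by
  have hρ2 : √ρ ^ 2 = ρ := Real.sq_sqrt hρ.le
  have hrow1 : ∀ a, ∑ i, ∑ j, rowMatrix e b w (x a) i j ^ 2 = 1 := fun a => by
    rw [sum_rowMatrix_sq, hw1, hx2, one_mul]
  have hgenF : ∀ (η : J → ℝ) a, ∑ i, ∑ u, genMatrix e b w η (x a) i u ^ 2 =
      ∑ c, (rowMatrix e b w (x a) *ᵥ η) c ^ 2 := fun η a => by
    rw [Fintype.sum_prod_type]
    simp_rw [genMatrix_apply]
  let bad : (J → ℤˣ) → Prop := fun η =>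
    ∃ a, α / 2 ≤ |∑ c, (rowMatrix e b w (x a) *ᵥ signVec η) c ^ 2 - 1|
  let dev : (J → ℤˣ) → (G → ℤˣ) → Prop := fun η s =>
    ¬ bad η ∧ ∃ a, α < |∑ i, (genMatrix e b w (signVec η) (x a) *ᵥ signVec s) i ^ 2 - 1|
  have hbad : 𝔼 η, (if bad η then (1 : ℝ) else 0) ≤ Real.exp (-2 * q) := by
    refine fourier_chaos_tail x hR (Real.sqrt_pos.2 hρ) (half_pos hα) (by linarith) q hq hx
      (fun y => rowMatrix e b w y) ?_ ?_ ?_ (Fintype.card_le_of_injective e he) hβ bad ?_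
    · intro y z
      ext c j
      simp only [rowMatrix, Matrix.of_apply, Matrix.sub_apply]
      split_ifs <;> ring
    · intro y N hy s
      rw [mul_pow, hρ2]
      exact sum_rowMatrix_mulVec_sq_le he b w hw y hy s
    · exact fun a => (hrow1 a).trans_le one_le_two
    · rintro η ⟨a, ha⟩
      exact ⟨a, by rwa [hrow1]⟩
  have hdev : ∀ η, 𝔼 s, (if dev η s then (1 : ℝ) else 0) ≤ Real.exp (-2 * q) := by
    intro η
    by_cases hη : bad η
    · simp only [dev, hη, not_true_eq_false, false_and, if_false, expect_const_zero]
      positivity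
    have hgood : ∀ a, |∑ c, (rowMatrix e b w (x a) *ᵥ signVec η) c ^ 2 - 1| < α / 2 := by
      simpa [bad] using hη
    refine fourier_chaos_tail x hR (Real.sqrt_pos.2 hρ) (half_pos hα) (by linarith) q hq hx
      (fun y => genMatrix e b w (signVec η) y) ?_ ?_ ?_ le_rfl hβ (dev η) ?_
    · intro y z
      ext i u
      simp only [genMatrix, Matrix.of_apply, Matrix.sub_apply, ← sum_sub_distrib]
      refine sum_congr rfl fun j _ => ?_
      split_ifs <;> ring
    · intro y N hy s
      rw [mul_pow, hρ2]
      exact sum_genMatrix_mulVec_sq_le he b w _ (signVec_sq η) hρ.le hw y hy s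
    · intro a
      rw [hgenF]
      linarith [(abs_lt.1 (hgood a)).2]
    · rintro s ⟨-, a, ha⟩
      refine ⟨a, ?_⟩
      rw [hgenF]
      have h1 := hgood a
      have h2 := abs_sub_le (∑ i, (genMatrix e b w (signVec η) (x a) *ᵥ signVec s) i ^ 2)
        (∑ c, (rowMatrix e b w (x a) *ᵥ signVec η) c ^ 2) 1
      linarith
  have hsplit : ∀ ω : (G → ℤˣ) × (J → ℤˣ), (if ∃ a, α < |∑ i, (∑ j, if b j = i then w j *
      (signVec ω.2 j * ∑ t, signVec ω.1 (e j - t) * x a t) else 0) ^ 2 - 1| then (1 : ℝ) else 0)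
      ≤ (if bad ω.2 then 1 else 0) + (if dev ω.2 ω.1 then 1 else 0) := by
    rintro ⟨s, η⟩
    simp only [dev, genMatrix_mulVec]
    by_cases h1 : bad η
    · simp only [h1, if_true, not_true_eq_false, false_and, if_false]
      split_ifs <;> norm_num
    · simp only [h1, if_false, not_false_eq_true, true_and, zero_add, le_refl]
  refine (expect_le_expect fun ω _ => hsplit ω).trans ?_
  rw [expect_add_distrib]
  have e1 : 𝔼 ω : (G → ℤˣ) × (J → ℤˣ), (if bad ω.2 then (1 : ℝ) else 0) =
      𝔼 s : G → ℤˣ, 𝔼 η, (if bad η then (1 : ℝ) else 0) := expect_prod _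
  have e2 : 𝔼 ω : (G → ℤˣ) × (J → ℤˣ), (if dev ω.2 ω.1 then (1 : ℝ) else 0) =
      𝔼 s, 𝔼 η, (if dev η s then (1 : ℝ) else 0) := expect_prod _
  rw [e1, e2, expect_comm (f := fun s η => if dev η s then (1 : ℝ) else 0), Fintype.expect_const]
  have h3 : 𝔼 η, 𝔼 s, (if dev η s then (1 : ℝ) else 0) ≤ 𝔼 η : J → ℤˣ, Real.exp (-2 * q) :=
    expect_le_expect fun η _ => hdev η
  rw [Fintype.expect_const] at h3
  linarith

end Blocks

theorem unifProb_eq {Ω : Type*} [Fintype Ω] (P : Ω → Prop) [DecidablePred P] [Nonempty Ω] :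
    unifProb P = 1 - 𝔼 ω, (if ¬ P ω then (1 : ℝ) else 0) := by
  have hcard : (Fintype.card Ω : ℝ) ≠ 0 := by exact_mod_cast Fintype.card_ne_zero
  have h1 : ∀ ω, (if ¬ P ω then (1 : ℝ) else 0) = 1 - (if P ω then 1 else 0) := fun ω => by
    by_cases h : P ω <;> simp [h]
  simp_rw [h1]
  rw [expect_sub_distrib, Fintype.expect_const, Fintype.expect_eq_sum_div_card, sum_boole,
    unifProb, Nat.card_eq_fintype_card, Fintype.card_subtype]
  ring

/-- The signs `±1` as units of the integers. -/
def boolUnits : Bool ≃ ℤˣ where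
  toFun b := if b then 1 else -1
  invFun u := decide (u = 1)
  left_inv b := by cases b <;> decide
  right_inv u := by rcases Int.units_eq_one_or u with rfl | rfl <;> decide

theorem rsign_eq_boolUnits (b : Bool) : rsign b = ((boolUnits b : ℤ) : ℝ) := by
  cases b <;> simp [rsign, boolUnits]

theorem sum_abs_le_of_mem_TkR {n k : ℕ} {x : Fin n → ℝ} (hx : x ∈ TkR n k) :
    ∑ j, |x j| ≤ √k := by
  obtain ⟨h1, s, hs, h0⟩ := hx
  have h2 : ∑ j, x j ^ 2 = 1 := by
    rwa [norm2, Real.sqrt_eq_one] at h1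
  refine Real.le_sqrt_of_sq_le ?_
  rw [← sum_subset (subset_univ s) fun t _ ht => by rw [h0 t ht, abs_zero]]
  calc (∑ j ∈ s, |x j|) ^ 2 ≤ s.card * ∑ j ∈ s, |x j| ^ 2 := sq_sum_le_card_mul_sum_sq
    _ ≤ k * 1 := by
        refine mul_le_mul (by exact_mod_cast hs) ?_ (sum_nonneg fun _ _ => sq_nonneg _)
          (Nat.cast_nonneg k)
        simp_rw [sq_abs]
        rw [← h2]
        exact sum_le_univ_sum_of_nonneg fun j => sq_nonneg _
    _ = k := mul_one _

theorem norm2_sq {n : ℕ} (x : Fin n → ℝ) : norm2 x ^ 2 = ∑ j, x j ^ 2 :=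
  Real.sq_sqrt (sum_nonneg fun _ _ => sq_nonneg _)

theorem norm2_pos {n : ℕ} {v : Fin n → ℝ} (hv : v ≠ 0) : 0 < norm2 v := by
  obtain ⟨j, hj⟩ := Function.ne_iff.1 hv
  refine Real.sqrt_pos.2 (sum_pos' (fun i _ => sq_nonneg _) ⟨j, mem_univ j, ?_⟩)
  exact sq_pos_of_ne_zero hj

theorem norm2_le_norm1 {n : ℕ} (v : Fin n → ℝ) : norm2 v ≤ norm1 v := by
  refine Real.sqrt_le_left (sum_nonneg fun _ _ => abs_nonneg _) |>.2 ?_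
  simp_rw [← sq_abs (v _)]
  exact sum_sq_le_sq_sum_of_nonneg fun i _ => abs_nonneg _

/-- The coefficient of the block measurement at a given row. -/
def blockWeight (p : ℕ) {lam : ℕ} (v : Fin lam → ℝ) (j : Fin (p * lam)) : ℝ :=
  1 / (norm2 v * √p) * v j.modNat

theorem kronRow_apply (p : ℕ) {lam : ℕ} (v : Fin lam → ℝ) (i : Fin p) (j : Fin (p * lam)) :
    kronRow p v i j = if j.divNat = i then v j.modNat else 0 := by
  have hlam : 0 < lam := Nat.pos_of_ne_zero fun h => by subst h; exact Fin.elim0 (by simpa using j)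
  have hmod : (j : ℕ) % lam < lam := Nat.mod_lt _ hlam
  simp only [kronRow, Matrix.of_apply, dif_pos hmod, Fin.ext_iff, Fin.coe_divNat]
  rfl

theorem sum_blockWeight_sq {p lam : ℕ} (hp : 0 < p) {v : Fin lam → ℝ} (hv : v ≠ 0) (i : Fin p) :
    ∑ j, (if Fin.divNat j = i then blockWeight p v j ^ 2 else 0) = 1 / p := by
  have hp' : (0 : ℝ) < p := by exact_mod_cast hp
  have hv' := norm2_pos hv
  rw [← finProdFinEquiv.sum_comp, Fintype.sum_prod_type]
  have h : ∀ (a : Fin p) (l : Fin lam), (finProdFinEquiv (a, l)).divNat = a ∧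
      (finProdFinEquiv (a, l)).modNat = l := fun a l =>
    Prod.mk.inj (finProdFinEquiv.symm_apply_apply (a, l))
  simp only [blockWeight, (h _ _).1, (h _ _).2]
  rw [sum_comm]
  simp only [sum_ite_eq', mem_univ, if_true, mul_pow, ← mul_sum, ← norm2_sq, div_pow,
    Real.sq_sqrt hp'.le]
  field_simp

theorem measurement_mulVec_apply {n p lam : ℕ} [NeZero n] (v : Fin lam → ℝ)
    (e : Fin (p * lam) → Fin n) (s : Fin n → ℝ) (η : Fin (p * lam) → ℝ) (x : Fin n → ℝ)
    (i : Fin p) :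
    ((((1 / (norm2 v * √p)) • kronRow p v) *
      Matrix.of fun j t => η j * Matrix.circulant s (e j) t).mulVec x) i =
    ∑ j, if Fin.divNat j = i then blockWeight p v j * (η j * ∑ t, s (e j - t) * x t) else 0 := by
  rw [← Matrix.mulVec_mulVec]
  simp only [Matrix.mulVec, dotProduct, Matrix.smul_apply, kronRow_apply, smul_eq_mul,
    Matrix.of_apply, Matrix.circulant_apply, mul_assoc, ← mul_sum, mul_ite, ite_mul, mul_zero,
    zero_mul, blockWeight]

theorem clog_le_three_mul_log {n : ℕ} (hn : 2 ≤ n) : (Nat.clog 2 n : ℝ) ≤ 3 * Real.log n := by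
  have hn' : (2 : ℝ) ≤ n := by exact_mod_cast hn
  have hl2 := Real.log_two_gt_d9
  have hl : Real.log 2 ≤ Real.log n := Real.log_le_log two_pos hn'
  have h1 : (Nat.clog 2 n : ℝ) ≤ Real.log n / Real.log 2 + 1 := by
    have := Real.natCeil_logb_natCast 2 n
    rw [← this]
    exact (Nat.ceil_lt_add_one (Real.logb_nonneg (by norm_num) (by linarith))).le
  refine h1.trans ?_
  rw [← sub_nonneg, show 3 * Real.log n - (Real.log n / Real.log 2 + 1) =
    (3 * Real.log n * Real.log 2 - Real.log n - Real.log 2) / Real.log 2 by field_simp; ring]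
  refine div_nonneg ?_ (by linarith)
  nlinarith

theorem log_four_mul_le {n : ℕ} (hn : 2 ≤ n) : Real.log (4 * n) ≤ 3 * Real.log n := by
  have hn' : (2 : ℝ) ≤ n := by exact_mod_cast hn
  have hl : Real.log 2 ≤ Real.log n := Real.log_le_log two_pos hn'
  rw [Real.log_mul (by norm_num) (by positivity), show (4 : ℝ) = 2 ^ 2 by norm_num, Real.log_pow]
  push_cast
  linarith

/-- The sample-size condition implies the smallness condition of the chaining bound. -/
theorem chaining_condition {n k p : ℕ} (hn : 2 ≤ n) (hp : 0 < p) {α ν γ : ℝ} (hα : 0 < α)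
    (hν : 0 < ν) (hγ : 1 ≤ γ)
    (h : 10 ^ 14 * (k : ℝ) * (Real.log n ^ 4 + γ ^ 2 * ν) / α ^ 2 ≤ p) :
    288 * (√(1 / p) * √k * (98 * √⌈ν⌉₊ + 144 * (6 * Real.log (4 * n)) * Nat.clog 2 n))
      ≤ α / 2 := by
  have hn' : (2 : ℝ) ≤ n := by exact_mod_cast hn
  have hp' : (0 : ℝ) < p := by exact_mod_cast hp
  set l := Real.log n with hl
  have hl0 : 0.69 ≤ l := by
    have := Real.log_le_log two_pos hn'
    linarith [Real.log_two_gt_d9]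
  have hq : (⌈ν⌉₊ : ℝ) ≤ ν + 1 := (Nat.ceil_lt_add_one hν.le).le
  have h1 : 144 * (6 * Real.log (4 * n)) * Nat.clog 2 n ≤ 7776 * l ^ 2 := by
    have h4 : 0 ≤ Real.log (4 * n) := Real.log_nonneg (by linarith)
    have := mul_le_mul (log_four_mul_le hn) (clog_le_three_mul_log hn) (Nat.cast_nonneg _)
      (by positivity)
    nlinarith
  set B := 98 * √⌈ν⌉₊ + 7776 * l ^ 2 with hB
  have hB0 : 0 ≤ B := by positivity
  have hl4 : 1 ≤ 5 * l ^ 4 := by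
    have : (0.69 : ℝ) ^ 4 ≤ l ^ 4 := pow_le_pow_left₀ (by norm_num) hl0 4
    norm_num at this
    linarith
  have hB2 : B ^ 2 ≤ 121028392 * (l ^ 4 + γ ^ 2 * ν) := by
    have hsq : √(⌈ν⌉₊ : ℝ) ^ 2 = ⌈ν⌉₊ := Real.sq_sqrt (Nat.cast_nonneg _)
    have h2 : B ^ 2 ≤ 2 * ((98 * √⌈ν⌉₊) ^ 2 + (7776 * l ^ 2) ^ 2) := add_sq_le
    rw [mul_pow, hsq] at h2
    have hγν : ν ≤ γ ^ 2 * ν := le_mul_of_one_le_left hν.le (by nlinarith)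
    nlinarith
  rw [div_le_iff₀ (by positivity)] at h
  have hfinal : (576 * (√(1 / p) * √k * B)) ^ 2 ≤ α ^ 2 := by
    rw [mul_pow, mul_pow, mul_pow, Real.sq_sqrt (by positivity), Real.sq_sqrt (Nat.cast_nonneg k),
      show (576 : ℝ) ^ 2 * (1 / p * k * B ^ 2) = 576 ^ 2 * (k * B ^ 2) / p by ring,
      div_le_iff₀ hp', mul_comm (α ^ 2)]
    refine le_trans ?_ h
    have : (k : ℝ) * B ^ 2 ≤ k * (121028392 * (l ^ 4 + γ ^ 2 * ν)) :=
      mul_le_mul_of_nonneg_left hB2 (Nat.cast_nonneg k)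
    have h0 : 0 ≤ (k : ℝ) * (l ^ 4 + γ ^ 2 * ν) := by positivity
    nlinarith
  have h5 := le_of_sq_le_sq hfinal hα.le
  have h6 : √(1 / p) * √k * (98 * √⌈ν⌉₊ + 144 * (6 * Real.log (4 * n)) * Nat.clog 2 n)
      ≤ √(1 / p) * √k * B :=
    mul_le_mul_of_nonneg_left (by linarith) (by positivity)
  linarith

theorem two_mul_exp_ceil_le {ν : ℝ} (hν : 0 < ν) :
    2 * Real.exp (-2 * ⌈ν⌉₊) ≤ Real.exp (-ν) := by
  have h1 : (1 : ℝ) ≤ ⌈ν⌉₊ := by exact_mod_cast Nat.ceil_pos.2 hν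
  have h2 : ν ≤ ⌈ν⌉₊ := Nat.le_ceil ν
  have h3 : (2 : ℝ) ≤ Real.exp 1 := by linarith [Real.add_one_le_exp (1 : ℝ)]
  calc 2 * Real.exp (-2 * ⌈ν⌉₊) ≤ Real.exp 1 * Real.exp (-2 * ⌈ν⌉₊) :=
        mul_le_mul_of_nonneg_right h3 (Real.exp_pos _).le
    _ = Real.exp (1 + -2 * ⌈ν⌉₊) := (Real.exp_add _ _).symm
    _ ≤ Real.exp (-ν) := Real.exp_le_exp.2 (by linarith)

theorem TkR_nonempty {n k : ℕ} [NeZero n] (hk : 0 < k) : (TkR n k).Nonempty := by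
  refine ⟨Pi.single 0 1, ?_, {0}, by simpa using Nat.succ_le_of_lt hk, fun t ht => ?_⟩
  · simp [norm2, Pi.single_apply]
  · simp only [mem_singleton] at ht
    simp [ht]

theorem ite_one_zero_mono {P Q : Prop} [Decidable P] [Decidable Q] (h : P → Q) :
    (if P then (1 : ℝ) else 0) ≤ if Q then 1 else 0 := by
  by_cases hP : P
  · simp [hP, h hP]
  · rw [if_neg hP]
    positivity

end Auxiliary

/-- high-probability restricted isometry property
`P( sup_{x ∈ T_k} | ‖V̂Φx‖₂² − ‖x‖₂² | ≤ α ) ≥ 1 − e^{−ν}` for `Φ` from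
the sign-randomized partial circulant ensemble (the retained row set `Ω`, `|Ω| = m`,
is encoded by the injection `e`), provided `m ≥ p ≥ C₂ k (log⁴ n + γ²ν)/α²`
with `γ = ‖v‖₁/‖v‖₂`. -/
theorem stmt15 :
    ∃ C₂ : ℝ, 0 < C₂ ∧
      ∀ (n k p lam : ℕ) (α ν γ : ℝ) (v : Fin lam → ℝ) (e : Fin (p * lam) → Fin n),
        2 ≤ n → 0 < k → k ≤ n → 0 < p → 0 < lam →
        0 < α → α < 1 → 0 < ν →
        Function.Injective e →
        v ≠ 0 →
        γ = norm1 v / norm2 v →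
        p ≤ p * lam →
        C₂ * (k : ℝ) * ((Real.log n) ^ 4 + γ ^ 2 * ν) / α ^ 2 ≤ (p : ℝ) →
        unifProb (fun ω : (Fin n → Bool) × (Fin (p * lam) → Bool) =>
            sSup {c : ℝ | ∃ x ∈ TkR n k,
              c = |(norm2 ((((1 / (norm2 v * Real.sqrt p)) • kronRow p v) *
                      Matrix.of fun j t =>
                        rsign (ω.2 j) * Matrix.circulant (fun s => rsign (ω.1 s)) (e j) t).mulVec
                        x)) ^ 2
                    - (norm2 x) ^ 2|} ≤ α)
          ≥ 1 - Real.exp (-ν) := by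
  classical
  refine ⟨10 ^ 14, by positivity, ?_⟩
  intro n k p lam α ν γ v e hn hk _ hp _ hα hα1 hν he hv hγ _ hsize
  have : NeZero n := ⟨by omega⟩
  have hk' : (0 : ℝ) < k := by exact_mod_cast hk
  have hp' : (0 : ℝ) < p := by exact_mod_cast hp
  have hγ1 : 1 ≤ γ := by
    rw [hγ, one_le_div (norm2_pos hv)]
    exact norm2_le_norm1 v
  have : Nonempty (TkR n k) := (TkR_nonempty hk).to_subtype
  have hunit : ∀ x : TkR n k, ∑ g, x.1 g ^ 2 = 1 := fun x => by
    rw [← norm2_sq, x.2.1, one_pow]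
  have hw1 : ∑ j, blockWeight p v j ^ 2 = 1 := by
    calc ∑ j, blockWeight p v j ^ 2
        = ∑ i : Fin p, ∑ j, (if Fin.divNat j = i then blockWeight p v j ^ 2 else 0) := by
          rw [Finset.sum_comm]
          simp
      _ = 1 := by
          simp_rw [sum_blockWeight_sq hp hv]
          simp [hp'.ne']
  have htail := randomized_convolution_tail he Fin.divNat (blockWeight p v) (ρ := 1 / p)
    (by positivity) (Real.sqrt_pos.2 hk') hα hα1.le (fun i => (sum_blockWeight_sq hp hv i).le) hw1
    (fun x : TkR n k => x.1) (fun x => sum_abs_le_of_mem_TkR x.2) hunit ⌈ν⌉₊ (Nat.ceil_pos.2 hν)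
    (by rw [Fintype.card_fin]; exact chaining_condition hn hp hα hν hγ1 hsize)
  rw [ge_iff_le, unifProb_eq]
  refine sub_le_sub_left (le_trans ?_ (htail.trans (two_mul_exp_ceil_le hν))) 1
  rw [← Fintype.expect_equiv
    ((Equiv.piCongrRight fun _ : Fin n => boolUnits).prodCongr
      (Equiv.piCongrRight fun _ : Fin (p * lam) => boolUnits)) _ _ fun ω => rfl]
  refine Finset.expect_le_expect fun ω _ => ?_
  refine ite_one_zero_mono fun hbad => ?_
  by_contra hcon
  push Not at hcon
  refine hbad (Real.sSup_le ?_ hα.le)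
  rintro _ ⟨x, hx, rfl⟩
  rw [norm2_sq, hx.1, one_pow]
  simp_rw [measurement_mulVec_apply v e (fun s => rsign (ω.1 s)) (fun j => rsign (ω.2 j)) x,
    rsign_eq_boolUnits]
  exact hcon ⟨x, hx⟩
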